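/- arXiv:1307.5709 — 3 statements merged into one kernel-verified Lean document; each statement's English description precedes it below -/
import Mathlib

section
/- Let X, Y be compact metric spaces, ω a finite Borel measure on X, p₁,…,p_N distinct points of Y and g₁,…,g_N > 0 with N ≥ 2. Let F ⊆ C(X) and T : F → C_s(X,Y) be such that F is T-convex (with (A1'), (A2')) and condition (A3'') holds. Assume ω(X) = Σᵢ gᵢ and that there exist bᵢ⁰ ∈ (α_{pᵢ},β_{pᵢ}) such that ρ₀ = max_{1≤i≤N} h_{bᵢ⁰,pᵢ} satisfies M_{T(ρ₀)}({pᵢ}) ≤ gᵢ for 2 ≤ i ≤ N. Then there exist bᵢ ∈ (α_{pᵢ},β_{pᵢ}) for 2 ≤ i ≤ N such that, with b₁ = b₁⁰, the function ρ(x) = max_{1≤i≤N} h_{bᵢ,pᵢ}(x) satisfies M_{T(ρ)} = Σᵢ gᵢ δ_{pᵢ}. -/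
open Filter MeasureTheory Topology

/-- `Φ⁻¹(E) = {x : Φ(x) ∩ E ≠ ∅}` for a set-valued map `Φ`. -/
def SVPreimage {X Y : Type*} (Φ : X → Set Y) (E : Set Y) : Set X :=
  {x | (Φ x ∩ E).Nonempty}

/-- Continuity of a set-valued map at a point. -/
def SVContinuousAt {X Y : Type*} [TopologicalSpace X] [TopologicalSpace Y]
    (Φ : X → Set Y) (x₀ : X) : Prop :=
  ∀ (xk : ℕ → X) (yk : ℕ → Y), Tendsto xk atTop (nhds x₀) → (∀ k, yk k ∈ Φ (xk k)) →
    ∃ (s : ℕ → ℕ) (y₀ : Y), StrictMono s ∧ y₀ ∈ Φ x₀ ∧ Tendsto (yk ∘ s) atTop (nhds y₀)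

/-- `Φ ∈ C_s(X,Y)`: nonempty values, continuous everywhere, single-valued `ω`-a.e.,
and surjective. -/
def IsCs {X Y : Type*} [TopologicalSpace X] [TopologicalSpace Y] [MeasurableSpace X]
    (ω : Measure X) (Φ : X → Set Y) : Prop :=
  (∀ x, (Φ x).Nonempty) ∧ (∀ x, SVContinuousAt Φ x) ∧
    (∀ᵐ x ∂ω, ∃ y, Φ x = {y}) ∧ (⋃ x, Φ x) = Set.univ

/-- Continuity of `T : F → C_s(X,Y)` at `φ ∈ F` (Definition 2.2). -/
def TContinuousAt {X Y : Type*} [TopologicalSpace X] [TopologicalSpace Y]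
    (F : Set C(X, ℝ)) (T : C(X, ℝ) → X → Set Y) (φ : C(X, ℝ)) : Prop :=
  ∀ φs : ℕ → C(X, ℝ), (∀ j, φs j ∈ F) →
    TendstoUniformly (fun j x => φs j x) (fun x => φ x) atTop →
    ∀ (x₀ : X) (ys : ℕ → Y), (∀ j, ys j ∈ T (φs j) x₀) →
      ∃ (s : ℕ → ℕ) (y₀ : Y), StrictMono s ∧ y₀ ∈ T φ x₀ ∧ Tendsto (ys ∘ s) atTop (nhds y₀)

/-- The set where the `i`-th function is the strict maximum. -/
def AStrict {X : Type*} [TopologicalSpace X] {N : ℕ} (H : Fin N → ℝ → C(X, ℝ))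
    (b : Fin N → ℝ) (i : Fin N) : Set X :=
  {x | ∀ j, j ≠ i → H j (b j) x < H i (b i) x}

theorem isOpen_AStrict {X : Type*} [TopologicalSpace X] {N : ℕ} (H : Fin N → ℝ → C(X, ℝ))
    (b : Fin N → ℝ) (i : Fin N) : IsOpen (AStrict H b i) := by
  have : AStrict H b i = ⋂ j, {x | j ≠ i → H j (b j) x < H i (b i) x} := by
    ext x; simp [AStrict]
  rw [this]
  refine isOpen_iInter_of_finite fun j => ?_
  by_cases hj : j = i
  · simp [hj]
  · simpa [hj] using isOpen_lt (H j (b j)).continuous (H i (b i)).continuous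

theorem disjoint_AStrict {X : Type*} [TopologicalSpace X] {N : ℕ} (H : Fin N → ℝ → C(X, ℝ))
    (b : Fin N → ℝ) {i j : Fin N} {x : X} (hi : x ∈ AStrict H b i) (hj : x ∈ AStrict H b j) :
    i = j := by
  by_contra hne
  exact lt_asymm (hi j (Ne.symm hne)) (hj i hne)

theorem contOn_AStrict {X : Type*} [TopologicalSpace X] [MeasurableSpace X]
    [OpensMeasurableSpace X] (ω : Measure X) [IsFiniteMeasure ω] {N : ℕ}
    (H : Fin N → ℝ → C(X, ℝ)) (S : Set (Fin N → ℝ))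
    (hc : ∀ i x, ContinuousOn (fun b : Fin N → ℝ => H i (b i) x) S)
    (hae : ∀ b ∈ S, ∀ᵐ x ∂ω, ∃ i, x ∈ AStrict H b i) (i : Fin N) :
    ContinuousOn (fun b => ω.real (AStrict H b i)) S := by
  intro b hb
  have key : Tendsto (fun b' => ω (AStrict H b' i)) (𝓝[S] b) (𝓝 (ω (AStrict H b i))) := by
    refine tendsto_measure_of_ae_tendsto_indicator_of_isFiniteMeasure (𝓝[S] b)
      (isOpen_AStrict H b i).measurableSet (fun b' => (isOpen_AStrict H b' i).measurableSet) ?_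
    filter_upwards [hae b hb] with x hx
    obtain ⟨k, hk⟩ := hx
    have hev : ∀ᶠ b' in 𝓝[S] b, x ∈ AStrict H b' k := by
      have : ∀ j, ∀ᶠ b' in 𝓝[S] b, j ≠ k → H j (b' j) x < H k (b' k) x := by
        intro j
        by_cases hj : j = k
        · simp [hj]
        · filter_upwards [((hc j x) b hb).eventually_lt ((hc k x) b hb) (hk j hj)] with b' hb' _
          exact hb'
      exact eventually_all.2 this
    filter_upwards [hev] with b' hb'
    constructor
    · intro h1
      rwa [disjoint_AStrict H b' h1 hb']
    · intro h1
      rwa [disjoint_AStrict H b h1 hk]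
  exact (ENNReal.tendsto_toReal (measure_ne_top ω _)).comp key

theorem core_exists {X : Type*} [TopologicalSpace X] [MeasurableSpace X]
    [OpensMeasurableSpace X] (ω : Measure X) [IsFiniteMeasure ω] {N : ℕ} [NeZero N]
    (H : Fin N → ℝ → C(X, ℝ)) (b0 t : Fin N → ℝ) (hbt : b0 ≤ t) (ht0 : t 0 = b0 0)
    (g : Fin N → ℝ) (hg : ∀ i, 0 < g i)
    (hc : ∀ i x, ContinuousOn (fun b : Fin N → ℝ => H i (b i) x) (Set.Icc b0 t))
    (hmono : ∀ i s r, b0 i ≤ s → s ≤ r → r ≤ t i → ∀ x, H i s x ≤ H i r x)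
    (hae : ∀ b ∈ Set.Icc b0 t, ∀ᵐ x ∂ω, ∃ i, x ∈ AStrict H b i)
    (hsum : ∀ b ∈ Set.Icc b0 t, ∑ i, ω.real (AStrict H b i) = ∑ i, g i)
    (hbig : ∀ i, i ≠ 0 → ∀ x, H 0 (b0 0) x < H i (t i) x)
    (hsmall : ∀ i, i ≠ 0 → ω.real (AStrict H b0 i) ≤ g i) :
    ∃ b ∈ Set.Icc b0 t, ∀ i, ω.real (AStrict H b i) = g i := by
  have hcont := contOn_AStrict ω H (Set.Icc b0 t) hc hae
  let W : Set (Fin N → ℝ) :=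
    ⋂ i : Fin N, (Set.Icc b0 t ∩ (fun b => ω.real (AStrict H b i)) ⁻¹' {r | i ≠ 0 → r ≤ g i})
  have hWmem : ∀ b, b ∈ W ↔ b ∈ Set.Icc b0 t ∧ ∀ i, i ≠ 0 → ω.real (AStrict H b i) ≤ g i := by
    intro b
    simp only [W, Set.mem_iInter]
    constructor
    · intro hb
      exact ⟨(hb 0).1, fun i => (hb i).2⟩
    · intro hb i
      exact ⟨hb.1, hb.2 i⟩
  have hWclosed : IsClosed W := by
    refine isClosed_iInter fun i => (hcont i).preimage_isClosed_of_isClosed isClosed_Icc ?_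
    by_cases hi : i = 0
    · simp [hi]
    · simpa [hi] using isClosed_le continuous_id (continuous_const (y := g i))
  have hWc : IsCompact W :=
    (isCompact_Icc (a := b0) (b := t)).of_isClosed_subset hWclosed
      (fun b hb => ((hWmem b).1 hb).1)
  have hb0W : b0 ∈ W := (hWmem b0).2 ⟨⟨le_rfl, hbt⟩, hsmall⟩
  obtain ⟨b, hbW, hmax⟩ := hWc.exists_isMaxOn ⟨b0, hb0W⟩
    (f := fun b : Fin N → ℝ => ∑ i, b i) (by fun_prop)
  obtain ⟨hbI, hbs⟩ := (hWmem b).1 hbW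
  have hb00 : b 0 = b0 0 := le_antisymm ((hbI.2 0).trans ht0.le) (hbI.1 0)
  have hlt : ∀ i, i ≠ 0 → b i < t i := by
    intro i hi
    refine lt_of_le_of_ne (hbI.2 i) fun he => ?_
    have hA : AStrict H b 0 = ∅ := by
      ext x
      simp only [Set.mem_empty_iff_false, iff_false]
      intro hx
      have h1 := hx i hi
      have h2 := hbig i hi x
      rw [hb00, he] at h1
      exact lt_asymm h1 h2
    have h3 : ∑ i, ω.real (AStrict H b i) < ∑ i, g i := by
      refine Finset.sum_lt_sum (fun j _ => ?_) ⟨0, Finset.mem_univ _, ?_⟩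
      · by_cases hj : j = 0
        · subst hj; simp [hA, (hg 0).le]
        · exact hbs j hj
      · simp [hA, hg 0]
    exact h3.ne (hsum b hbI)
  have heq : ∀ i, i ≠ 0 → ω.real (AStrict H b i) = g i := by
    intro i hi
    by_contra hne
    have hl : ω.real (AStrict H b i) < g i := lt_of_le_of_ne (hbs i hi) hne
    have hupI : ∀ s ∈ Set.Icc (b i) (t i), Function.update b i s ∈ Set.Icc b0 t := by
      intro s hs
      constructor
      · intro j
        by_cases hj : j = i
        · subst hj; simpa using (hbI.1 j).trans hs.1
        · simpa [hj] using hbI.1 j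
      · intro j
        by_cases hj : j = i
        · subst hj; simpa using hs.2
        · simpa [hj] using hbI.2 j
    have hcs : ContinuousOn (fun s => ω.real (AStrict H (Function.update b i s) i))
        (Set.Icc (b i) (t i)) :=
      (hcont i).comp (f := fun s => Function.update b i s)
        (by
          have hu : Continuous (fun s : ℝ => Function.update b i s) :=
            (continuous_const (y := b)).update i continuous_id
          exact hu.continuousOn) hupI
    have hcw := hcs (b i) ⟨le_rfl, (hlt i hi).le⟩
    have hev : ∀ᶠ s in 𝓝[Set.Icc (b i) (t i)] (b i),
        ω.real (AStrict H (Function.update b i s) i) < g i := by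
      refine hcw.eventually_lt continuousWithinAt_const ?_
      simpa using hl
    have hev' : ∀ᶠ s in 𝓝[>] (b i), s ∈ Set.Ioc (b i) (t i) ∧
        ω.real (AStrict H (Function.update b i s) i) < g i := by
      have h1 : 𝓝[Set.Ioc (b i) (t i)] (b i) = 𝓝[>] (b i) :=
        nhdsWithin_Ioc_eq_nhdsGT (hlt i hi)
      rw [← h1]
      exact (eventually_mem_nhdsWithin).and
        (hev.filter_mono (nhdsWithin_mono _ Set.Ioc_subset_Icc_self))
    obtain ⟨s, hs, hsl⟩ := hev'.exists
    have hsI : s ∈ Set.Icc (b i) (t i) := Set.Ioc_subset_Icc_self hs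
    have hupW : Function.update b i s ∈ W := by
      refine (hWmem _).2 ⟨hupI s hsI, fun j hj => ?_⟩
      by_cases hji : j = i
      · subst hji; exact hsl.le
      · refine le_trans (measureReal_mono ?_) (hbs j hj)
        intro x hx k hk
        have h1 := hx k hk
        rw [Function.update_of_ne hji] at h1
        refine lt_of_le_of_lt ?_ h1
        by_cases hki : k = i
        · subst hki
          simpa using hmono k _ _ (hbI.1 k) hs.1.le hs.2 x
        · simp [hki]
    have h2 : ∑ k, Function.update b i s k ≤ ∑ k, b k := hmax hupW
    have h3 : ∑ k, b k < ∑ k, Function.update b i s k := by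
      refine Finset.sum_lt_sum (fun j _ => ?_) ⟨i, Finset.mem_univ _, by simpa using hs.1⟩
      by_cases hj : j = i
      · subst hj; simpa using hs.1.le
      · simp [hj]
    exact absurd h3 (not_lt.2 h2)
  refine ⟨b, hbI, fun i => ?_⟩
  by_cases hi : i = 0
  · subst hi
    have h1 := hsum b hbI
    rw [← Finset.add_sum_erase _ _ (Finset.mem_univ (0 : Fin N)),
      ← Finset.add_sum_erase _ g (Finset.mem_univ (0 : Fin N)),
      Finset.sum_congr rfl (fun j hj => heq j (Finset.ne_of_mem_erase hj))] at h1
    linarith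
  · exact heq i hi

/-- Theorem 2.12 (convex case "at infinity": (A3'') with h → +∞ as t → β⁻,
F ⊆ C(X) without positivity). -/
theorem stmt8 {X Y : Type*} [MetricSpace X] [CompactSpace X] [MetricSpace Y] [CompactSpace Y]
    [MeasurableSpace X] [BorelSpace X] [MeasurableSpace Y] [BorelSpace Y]
    (ω : Measure X) [IsFiniteMeasure ω]
    (F : Set C(X, ℝ)) (T : C(X, ℝ) → X → Set Y)
    (α β : Y → EReal) (h : ℝ → Y → C(X, ℝ))
    -- (A1')
    (hA1 : ∀ f₁ ∈ F, ∀ f₂ ∈ F, f₁ ⊔ f₂ ∈ F)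
    -- T maps F into C_s(X,Y)
    (hTCs : ∀ f ∈ F, IsCs ω (T f))
    -- T is continuous at each φ ∈ F
    (hTcont : ∀ φ ∈ F, TContinuousAt F T φ)
    -- (A2')
    (hA2 : ∀ φ₁ ∈ F, ∀ φ₂ ∈ F, ∀ x₀ : X, φ₂ x₀ ≤ φ₁ x₀ → T φ₁ x₀ ⊆ T (φ₁ ⊔ φ₂) x₀)
    -- (A3'')
    (hA3mem : ∀ (y : Y) (t : ℝ), α y < (t : EReal) → (t : EReal) < β y → h t y ∈ F)
    (hA3a : ∀ (y : Y) (t : ℝ), α y < (t : EReal) → (t : EReal) < β y → ∀ x : X, y ∈ T (h t y) x)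
    (hA3b : ∀ (y : Y) (t s : ℝ), α y < (t : EReal) → (s : EReal) < β y → t ≤ s →
      ∀ x, h t y x ≤ h s y x)
    (hA3c : ∀ (y : Y), ∀ Mc : ℝ, ∃ t₀ : ℝ, α y < (t₀ : EReal) ∧ (t₀ : EReal) < β y ∧
      ∀ t : ℝ, t₀ ≤ t → (t : EReal) < β y → ∀ x, Mc ≤ h t y x)
    (hA3d : ∀ (y : Y) (t : ℝ), α y < (t : EReal) → (t : EReal) < β y →
      ∀ ε : ℝ, 0 < ε → ∃ δ : ℝ, 0 < δ ∧ ∀ t' : ℝ, α y < (t' : EReal) → (t' : EReal) < β y →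
        |t' - t| < δ → ∀ x, |h t' y x - h t y x| ≤ ε)
    -- the data
    {N : ℕ} [NeZero N] (hN : 2 ≤ N)
    (p : Fin N → Y) (hp : Function.Injective p)
    (g : Fin N → ℝ) (hg : ∀ i, 0 < g i)
    -- conservation of energy
    (hmass : ω Set.univ = ∑ i, ENNReal.ofReal (g i))
    -- existence of ρ₀ = max h_{bᵢ⁰,pᵢ} with M_{T(ρ₀)}({pᵢ}) ≤ gᵢ for i ≥ 2
    (b0 : Fin N → ℝ) (hb0 : ∀ i, α (p i) < (b0 i : EReal) ∧ (b0 i : EReal) < β (p i))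
    (ρ0 : C(X, ℝ)) (hρ0 : ∀ x, ρ0 x = ⨆ i, h (b0 i) (p i) x)
    (hρ0small : ∀ i : Fin N, i ≠ 0 → ω (SVPreimage (T ρ0) {p i}) ≤ ENNReal.ofReal (g i)) :
    ∃ b : Fin N → ℝ, b 0 = b0 0 ∧
      (∀ i, α (p i) < (b i : EReal) ∧ (b i : EReal) < β (p i)) ∧
      ∃ ρ : C(X, ℝ), (∀ x, ρ x = ⨆ i, h (b i) (p i) x) ∧
        ∀ E : Set Y, MeasurableSet E →
          ω (SVPreimage (T ρ) E) = ∑ i, E.indicator (fun _ => ENNReal.ofReal (g i)) (p i) := by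
  classical
  let H : Fin N → ℝ → C(X, ℝ) := fun i s => h s (p i)
  let R : (Fin N → ℝ) → C(X, ℝ) := fun b =>
    Finset.univ.sup' Finset.univ_nonempty (fun i => H i (b i))
  have hRx : ∀ b x, R b x = ⨆ i, h (b i) (p i) x := by
    intro b x
    simp only [R, ContinuousMap.sup'_apply, Finset.sup'_univ_eq_ciSup, H]
  let Val : (Fin N → ℝ) → Prop := fun b =>
    ∀ i, α (p i) < (b i : EReal) ∧ (b i : EReal) < β (p i)
  have hRF : ∀ b, Val b → R b ∈ F := by
    intro b hb
    exact Finset.sup'_induction _ _ (fun f hf f' hf' => hA1 f hf f' hf')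
      (fun i _ => hA3mem _ _ (hb i).1 (hb i).2)
  have hle : ∀ b i x, H i (b i) x ≤ R b x := by
    intro b i x
    rw [hRx]
    exact le_ciSup (f := fun i => h (b i) (p i) x) (Set.finite_range _).bddAbove i
  have hatt : ∀ b, Val b → ∀ i x, H i (b i) x = R b x → p i ∈ T (R b) x := by
    intro b hb i x hx
    have h1 := hA2 (H i (b i)) (hA3mem _ _ (hb i).1 (hb i).2) (R b) (hRF b hb) x hx.ge
      (hA3a _ _ (hb i).1 (hb i).2 x)
    have h2 : H i (b i) ⊔ R b = R b := sup_eq_right.2 (fun x => hle b i x)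
    rwa [h2] at h1
  have hkey : ∀ b, Val b → ∀ᵐ x ∂ω, ∃ i, T (R b) x = {p i} ∧ x ∈ AStrict H b i := by
    intro b hb
    filter_upwards [(hTCs _ (hRF b hb)).2.2.1] with x hx
    obtain ⟨y, hy⟩ := hx
    obtain ⟨i, hi⟩ := exists_eq_ciSup_of_finite (f := fun i => h (b i) (p i) x)
    rw [← hRx] at hi
    have hpi := hatt b hb i x hi
    have hyi : p i = y := by rw [hy] at hpi; exact hpi
    refine ⟨i, by rw [hy, hyi], fun j hj => ?_⟩
    have h1 : H i (b i) x = R b x := hi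
    rw [h1]
    refine lt_of_le_of_ne (hle b j x) fun he => hj ?_
    have hpj := hatt b hb j x he
    rw [hy] at hpj
    exact hp (hpj.trans hyi.symm)
  have hpre : ∀ b, Val b → ∀ E : Set Y, ω (SVPreimage (T (R b)) E) =
      ∑ i, E.indicator (fun _ => ω (AStrict H b i)) (p i) := by
    intro b hb E
    have h1 : SVPreimage (T (R b)) E =ᵐ[ω]
        (⋃ i ∈ Finset.univ.filter (fun i => p i ∈ E), AStrict H b i : Set X) := by
      filter_upwards [hkey b hb] with x hx
      obtain ⟨k, hk, hkA⟩ := hx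
      apply propext
      change (T (R b) x ∩ E).Nonempty ↔
        x ∈ (⋃ i ∈ Finset.univ.filter (fun i => p i ∈ E), AStrict H b i : Set X)
      rw [hk, Set.singleton_inter_nonempty]
      simp only [Set.mem_iUnion, Finset.mem_filter, Finset.mem_univ, true_and, exists_prop]
      constructor
      · exact fun hE => ⟨k, hE, hkA⟩
      · rintro ⟨i, hE, hiA⟩
        rwa [disjoint_AStrict H b hkA hiA]
    rw [measure_congr h1, measure_biUnion_finset, Finset.sum_filter]
    · refine Finset.sum_congr rfl fun i _ => ?_
      simp [Set.indicator_apply]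
    · intro i _ j _ hij
      exact Set.disjoint_left.2 fun x hx hx' => hij (disjoint_AStrict H b hx hx')
    · exact fun i _ => (isOpen_AStrict H b i).measurableSet
  have hV0 : Val b0 := hb0
  have hρR : ρ0 = R b0 := by ext x; rw [hρ0, hRx]
  -- the upper barrier
  have hbar : ∀ i : Fin N, ∃ r : ℝ, b0 i ≤ r ∧ (r : EReal) < β (p i) ∧
      ∀ x, H 0 (b0 0) x < H i r x := by
    intro i
    obtain ⟨M, hM⟩ := (isCompact_range (H 0 (b0 0)).continuous).bddAbove
    obtain ⟨t₀, h1, h2, h3⟩ := hA3c (p i) (M + 1)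
    refine ⟨max (b0 i) t₀, le_max_left _ _, ?_, fun x => ?_⟩
    · rcases max_choice (b0 i) t₀ with h | h <;> rw [h]
      · exact (hb0 i).2
      · exact h2
    · have h4 := hM (Set.mem_range_self x)
      have h5 : M + 1 ≤ H i (max (b0 i) t₀) x := by
        refine h3 _ (le_max_right _ _) ?_ x
        rcases max_choice (b0 i) t₀ with h | h <;> rw [h]
        · exact (hb0 i).2
        · exact h2
      linarith
  choose r hr1 hr2 hr3 using hbar
  let t : Fin N → ℝ := fun i => if i = 0 then b0 0 else r i
  have hbt : b0 ≤ t := by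
    intro i
    by_cases hi : i = 0
    · subst hi; simp [t]
    · simpa [t, hi] using hr1 i
  have htβ : ∀ i, (t i : EReal) < β (p i) := by
    intro i
    by_cases hi : i = 0
    · subst hi; simpa [t] using (hb0 0).2
    · simpa [t, hi] using hr2 i
  have hlow : ∀ i (s : ℝ), b0 i ≤ s → α (p i) < (s : EReal) := fun i s hs =>
    lt_of_lt_of_le (hb0 i).1 (EReal.coe_le_coe_iff.2 hs)
  have hup : ∀ i (s : ℝ), s ≤ t i → (s : EReal) < β (p i) := fun i s hs =>
    lt_of_le_of_lt (EReal.coe_le_coe_iff.2 hs) (htβ i)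
  have hVal : ∀ b ∈ Set.Icc b0 t, Val b := fun b hb i =>
    ⟨hlow i _ (hb.1 i), hup i _ (hb.2 i)⟩
  obtain ⟨b, hbI, hbg⟩ := core_exists ω H b0 t hbt (by simp [t]) g hg
    (by
      intro i x b hb
      refine Metric.continuousWithinAt_iff.2 fun ε hε => ?_
      obtain ⟨δ, hδ, h1⟩ := hA3d (p i) (b i) (hVal b hb i).1 (hVal b hb i).2 (ε / 2) (half_pos hε)
      refine ⟨δ, hδ, fun b' hb' hd => ?_⟩
      have h2 : |b' i - b i| < δ := lt_of_le_of_lt (dist_le_pi_dist b' b i) hd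
      have h3 := h1 (b' i) (hVal b' hb' i).1 (hVal b' hb' i).2 h2 x
      rw [Real.dist_eq]
      exact lt_of_le_of_lt h3 (half_lt_self hε))
    (fun i s q hs hsq hq x => hA3b _ _ _ (hlow i s hs) (hup i q hq) hsq x)
    (fun b hb => by
      filter_upwards [hkey b (hVal b hb)] with x hx
      obtain ⟨i, _, hi⟩ := hx
      exact ⟨i, hi⟩)
    (by
      intro b hb
      have h1 := hpre b (hVal b hb) Set.univ
      have h2 : SVPreimage (T (R b)) Set.univ = Set.univ := by
        ext x
        simpa [SVPreimage] using (hTCs _ (hRF b (hVal b hb))).1 x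
      rw [h2, hmass] at h1
      simp only [Set.indicator_univ] at h1
      have h3 := congrArg ENNReal.toReal h1
      rw [ENNReal.toReal_sum (fun _ _ => ENNReal.ofReal_ne_top),
        ENNReal.toReal_sum (fun _ _ => measure_ne_top _ _)] at h3
      simp only [ENNReal.toReal_ofReal (hg _).le] at h3
      exact h3.symm)
    (fun i hi x => by simpa [t, hi] using hr3 i x)
    (by
      intro i hi
      have h1 := hρ0small i hi
      rw [hρR, hpre b0 hV0, Finset.sum_eq_single i] at h1
      · simp only [Set.mem_singleton_iff, Set.indicator_of_mem] at h1
        exact ENNReal.toReal_le_of_le_ofReal (hg i).le h1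
      · intro j _ hj
        have hne : p j ∉ ({p i} : Set Y) := fun hh => hj (hp hh)
        exact Set.indicator_of_notMem hne _
      · simp)
  refine ⟨b, ?_, hVal b hbI, R b, hRx b, fun E _ => ?_⟩
  · exact le_antisymm ((hbI.2 0).trans (by simp [t])) (hbI.1 0)
  · rw [hpre b (hVal b hbI)]
    have : ∀ i, ω (AStrict H b i) = ENNReal.ofReal (g i) := by
      intro i
      rw [← hbg i, ofReal_measureReal]
    simp only [this]
end

section
/- Assume (H1) and (H2) with 0 < κ < 1 and that ∂Ω has zero surface measure in S^{n−1}. Let μ be a Radon measure on D and f ∈ L¹(Ω) with f > 0 a.e. and ∫_Ω f dσ = μ(D). Then for every X₀ ∈ Q_{r₀} with 0 < |X₀| < ((1 − κ)/(1 + κ))³ r₀, there exists a near field refractor S with radial function ρ passing through X₀ (i.e. ρ(X₀/|X₀|) = |X₀|) which is a weak solution: M_{S,f}(F) = μ(F) for every Borel set F ⊆ D. -/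
open MeasureTheory
open scoped RealInnerProductSpace

/-- The discriminant `Δ(t) = (b − κ²t)² − (1 − κ²)(b² − κ²|P|²)` of the quadratic equation
defining the polar radius of the Cartesian oval `|X| + κ|X − P| = b` (case `κ < 1`). -/
noncomputable def ovalDelta (κ b normP t : ℝ) : ℝ :=
  (b - κ ^ 2 * t) ^ 2 - (1 - κ ^ 2) * (b ^ 2 - κ ^ 2 * normP ^ 2)

/-- The polar radius `h(x,P,b)` of the refracting Cartesian oval (case `κ < 1`). -/
noncomputable def ovalH {n : ℕ} (κ b : ℝ) (P x : EuclideanSpace ℝ (Fin n)) : ℝ :=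
  ((b - κ ^ 2 * ⟪x, P⟫) - Real.sqrt (ovalDelta κ b ‖P‖ ⟪x, P⟫)) / (1 - κ ^ 2)

/-- Surface measure on the unit sphere of `ℝⁿ`: the `(n−1)`-dimensional Hausdorff measure
restricted to the sphere. -/
noncomputable def sphereMeasure (n : ℕ) : Measure (EuclideanSpace ℝ (Fin n)) :=
  (μH[(n : ℝ) - 1] : Measure (EuclideanSpace ℝ (Fin n))).restrict (Metric.sphere 0 1)

/-- The cone `Q_{r₀} = {tx : x ∈ Ω̄, 0 < t ≤ r₀}`. -/
def coneQ {n : ℕ} (Ω : Set (EuclideanSpace ℝ (Fin n))) (r₀ : ℝ) :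
    Set (EuclideanSpace ℝ (Fin n)) :=
  {Z | ∃ x ∈ closure Ω, ∃ t : ℝ, 0 < t ∧ t ≤ r₀ ∧ Z = t • x}

/-- The oval `O(P,b)` supports the surface given by the radial function `ρ` at the point
`ρ(y)y` (case `κ < 1`): `κ|P| < b < |P|`, `x·P ≥ b` on `Ω̄`, `ρ ≤ h(·,P,b)` on `Ω̄` with
equality at `y`. -/
def SupportsAtLt {n : ℕ} (κ : ℝ) (Ω : Set (EuclideanSpace ℝ (Fin n)))
    (ρ : EuclideanSpace ℝ (Fin n) → ℝ) (P : EuclideanSpace ℝ (Fin n)) (b : ℝ)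
    (y : EuclideanSpace ℝ (Fin n)) : Prop :=
  κ * ‖P‖ < b ∧ b < ‖P‖ ∧ (∀ x ∈ closure Ω, b ≤ ⟪x, P⟫) ∧
    (∀ x ∈ closure Ω, ρ x ≤ ovalH κ b P x) ∧ ρ y = ovalH κ b P y

/-- Near field refractor for `κ < 1` (Definition 5.1): a continuous radial function
`ρ : Ω̄ → (0, r₀]` such that at every point there is a supporting oval with focus in `D`. -/
def IsNearFieldRefractorLt {n : ℕ} (κ r₀ : ℝ) (Ω D : Set (EuclideanSpace ℝ (Fin n)))
    (ρ : EuclideanSpace ℝ (Fin n) → ℝ) : Prop :=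
  ContinuousOn ρ (closure Ω) ∧ (∀ x ∈ closure Ω, 0 < ρ x ∧ ρ x ≤ r₀) ∧
    ∀ y ∈ closure Ω, ∃ P ∈ D, ∃ b : ℝ, SupportsAtLt κ Ω ρ P b y

/-- The near field refractor map `R_S(x)` (case `κ < 1`). -/
def refractorMapLt {n : ℕ} (κ : ℝ) (Ω D : Set (EuclideanSpace ℝ (Fin n)))
    (ρ : EuclideanSpace ℝ (Fin n) → ℝ) (x : EuclideanSpace ℝ (Fin n)) :
    Set (EuclideanSpace ℝ (Fin n)) :=
  {P | P ∈ D ∧ ∃ b : ℝ, SupportsAtLt κ Ω ρ P b x}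

/-- `R_S⁻¹(F) = {x ∈ Ω̄ : R_S(x) ∩ F ≠ ∅}` (case `κ < 1`). -/
def refractorPreimageLt {n : ℕ} (κ : ℝ) (Ω D : Set (EuclideanSpace ℝ (Fin n)))
    (ρ : EuclideanSpace ℝ (Fin n) → ℝ) (F : Set (EuclideanSpace ℝ (Fin n))) :
    Set (EuclideanSpace ℝ (Fin n)) :=
  {x | x ∈ closure Ω ∧ (refractorMapLt κ Ω D ρ x ∩ F).Nonempty}

/-- The cost `t + κ|t x - P|`. -/
noncomputable def ovCost {n : ℕ} (κ : ℝ) (P x : EuclideanSpace ℝ (Fin n)) (t : ℝ) : ℝ :=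
  t + κ * ‖t • x - P‖

section Oval
variable {n : ℕ} {κ : ℝ} {P x : EuclideanSpace ℝ (Fin n)}

lemma ovCost_le_of (hκ0 : 0 < κ) (hx : ‖x‖ = 1) {t t' : ℝ} (h : t ≤ t') :
    ovCost κ P x t' ≤ ovCost κ P x t + (1 + κ) * (t' - t) := by
  have : ‖t' • x - P‖ ≤ ‖t • x - P‖ + (t' - t) := by
    have h1 : t' • x - P = (t • x - P) + (t' - t) • x := by rw [sub_smul]; abel
    rw [h1]
    refine (norm_add_le _ _).trans ?_
    rw [norm_smul, hx, Real.norm_of_nonneg (by linarith)]; simp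
  unfold ovCost
  nlinarith

lemma ovCost_ge_of (hκ0 : 0 < κ) (hx : ‖x‖ = 1) {t t' : ℝ} (h : t ≤ t') :
    ovCost κ P x t + (1 - κ) * (t' - t) ≤ ovCost κ P x t' := by
  have : ‖t • x - P‖ ≤ ‖t' • x - P‖ + (t' - t) := by
    have h1 : t • x - P = (t' • x - P) + (t - t') • x := by rw [sub_smul]; abel
    rw [h1]
    refine (norm_add_le _ _).trans ?_
    rw [norm_smul, hx, Real.norm_of_nonpos (by linarith)]; simp
  unfold ovCost
  nlinarith

lemma ovCost_upper (hκ0 : 0 < κ) (hx : ‖x‖ = 1) {t : ℝ} (h : 0 ≤ t) :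
    ovCost κ P x t ≤ κ * ‖P‖ + (1 + κ) * t := by
  have := ovCost_le_of (P := P) hκ0 hx h
  simpa [ovCost] using this

lemma ovCost_lower (hκ0 : 0 < κ) (hx : ‖x‖ = 1) {t : ℝ} (h : 0 ≤ t) :
    κ * ‖P‖ + (1 - κ) * t ≤ ovCost κ P x t := by
  have := ovCost_ge_of (P := P) hκ0 hx h
  simpa [ovCost] using this

/-- `h` is the polar radius: `t ≤ h ↔ cost ≤ b`. -/
lemma le_ovalH_iff (hκ0 : 0 < κ) (hκ1 : κ < 1) (hx : ‖x‖ = 1) {b : ℝ}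
    (hb1 : κ * ‖P‖ < b) (hb2 : b < ‖P‖) (t : ℝ) :
    t ≤ ovalH κ b P x ↔ ovCost κ P x t ≤ b := by
  set a := ⟪x, P⟫ with ha
  have hap : a ≤ ‖P‖ := by
    have := real_inner_le_norm x P
    rwa [hx, one_mul] at this
  set p := ‖P‖ with hp
  have hp0 : 0 ≤ p := norm_nonneg _
  have hb0 : 0 < b := lt_of_le_of_lt (by positivity) hb1
  have hk2 : 0 < 1 - κ ^ 2 := by nlinarith
  have hns : ‖t • x - P‖ ^ 2 = t ^ 2 - 2 * t * a + p ^ 2 := by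
    rw [norm_sub_sq_real, norm_smul, hx, real_inner_smul_left, mul_one, Real.norm_eq_abs, sq_abs]
    ring
  set Δ := ovalDelta κ b p a with hΔ
  have hqb : b ^ 2 * (1 - κ ^ 2) - 2 * (b - κ ^ 2 * a) * b + (b ^ 2 - κ ^ 2 * p ^ 2) < 0 := by
    have h1 : 0 < (p - b) ^ 2 := by have : 0 < p - b := by linarith
                                    positivity
    have h2 : 0 < κ ^ 2 := by positivity
    have h3 : 0 < κ ^ 2 * (p - b) ^ 2 := by positivity
    have h4 : 0 ≤ κ ^ 2 * b * (p - a) := by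
      have : 0 ≤ p - a := by linarith
      positivity
    nlinarith
  have key : ∀ s : ℝ, (1 - κ ^ 2) * (s ^ 2 * (1 - κ ^ 2) - 2 * (b - κ ^ 2 * a) * s +
      (b ^ 2 - κ ^ 2 * p ^ 2)) = ((1 - κ ^ 2) * s - (b - κ ^ 2 * a)) ^ 2 - Δ := by
    intro s; rw [hΔ, ovalDelta]; ring
  have hkb : ((1 - κ ^ 2) * b - (b - κ ^ 2 * a)) ^ 2 < Δ := by
    have := key b
    nlinarith [mul_pos hk2 (neg_pos.mpr hqb)]
  have hΔ0 : 0 < Δ := lt_of_le_of_lt (sq_nonneg _) hkb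
  set s := Real.sqrt Δ with hs
  have hs2 : s ^ 2 = Δ := Real.sq_sqrt hΔ0.le
  have hs0 : 0 < s := Real.sqrt_pos.mpr hΔ0
  have hab := abs_lt_of_sq_lt_sq (hkb.trans_eq hs2.symm) hs0.le
  rw [abs_lt] at hab
  have hH : ovalH κ b P x = ((b - κ ^ 2 * a) - s) / (1 - κ ^ 2) := rfl
  rw [hH, le_div_iff₀ hk2]
  have hN0 : 0 ≤ ‖t • x - P‖ := norm_nonneg _
  have hkt := key t
  unfold ovCost
  constructor
  · intro h
    have htb : t < b := by
      have h6 : (1 - κ ^ 2) * t < (1 - κ ^ 2) * b := by linarith [hab.1]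
      exact lt_of_mul_lt_mul_left h6 hk2.le
    have h1 : s ^ 2 ≤ ((1 - κ ^ 2) * t - (b - κ ^ 2 * a)) ^ 2 := by nlinarith
    have h2 : 0 ≤ t ^ 2 * (1 - κ ^ 2) - 2 * (b - κ ^ 2 * a) * t + (b ^ 2 - κ ^ 2 * p ^ 2) := by
      by_contra hc
      push Not at hc
      have h7 := mul_pos hk2 (neg_pos.mpr hc)
      linarith
    have h3 : (κ * ‖t • x - P‖) ^ 2 ≤ (b - t) ^ 2 := by
      rw [mul_pow, hns]; nlinarith
    have := abs_le_of_sq_le_sq h3 (by linarith)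
    linarith [(abs_le.mp this).2]
  · intro h
    have htb : t ≤ b := by nlinarith [mul_nonneg hκ0.le hN0]
    have h3 : (κ * ‖t • x - P‖) ^ 2 ≤ (b - t) ^ 2 := by
      apply pow_le_pow_left₀ (by positivity); linarith
    rw [mul_pow, hns] at h3
    have h2 : 0 ≤ t ^ 2 * (1 - κ ^ 2) - 2 * (b - κ ^ 2 * a) * t + (b ^ 2 - κ ^ 2 * p ^ 2) := by
      nlinarith
    have h1 : s ^ 2 ≤ ((1 - κ ^ 2) * t - (b - κ ^ 2 * a)) ^ 2 := by
      have h5 := mul_nonneg hk2.le h2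
      rw [hkt] at h5
      linarith
    by_contra hc
    push Not at hc
    have hup : (1 - κ ^ 2) * t - (b - κ ^ 2 * a) < s := by
      have h6 := mul_le_mul_of_nonneg_left htb hk2.le
      linarith [hab.2]
    have := sq_lt_sq' (by linarith) hup
    linarith

lemma ovCost_ovalH (hκ0 : 0 < κ) (hκ1 : κ < 1) (hx : ‖x‖ = 1) {b : ℝ}
    (hb1 : κ * ‖P‖ < b) (hb2 : b < ‖P‖) : ovCost κ P x (ovalH κ b P x) = b := by
  have hle := (le_ovalH_iff hκ0 hκ1 hx hb1 hb2 _).1 le_rfl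
  refine le_antisymm hle ?_
  by_contra hc
  push Not at hc
  set h := ovalH κ b P x
  have hε : 0 < (b - ovCost κ P x h) / (1 + κ) := by
    apply div_pos <;> linarith
  set ε := (b - ovCost κ P x h) / (1 + κ) with hεd
  have h1 := ovCost_le_of (P := P) hκ0 hx (show h ≤ h + ε by linarith)
  have h2 : (1 + κ) * (h + ε - h) = b - ovCost κ P x h := by
    rw [hεd]; field_simp; ring
  have := (le_ovalH_iff hκ0 hκ1 hx hb1 hb2 (h + ε)).2 (by linarith)
  have : h + ε ≤ h := this
  linarith

lemma ovalH_mono (hκ0 : 0 < κ) (hκ1 : κ < 1) (hx : ‖x‖ = 1) {b b' : ℝ}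
    (hb1 : κ * ‖P‖ < b) (hb2 : b' < ‖P‖) (hbb : b ≤ b') : ovalH κ b P x ≤ ovalH κ b' P x := by
  rw [le_ovalH_iff hκ0 hκ1 hx (by linarith) hb2, ovCost_ovalH hκ0 hκ1 hx hb1 (by linarith)]
  exact hbb

end Oval

section Geometry
variable {E : Type*} [NormedAddCommGroup E] [InnerProductSpace ℝ E]

/-- Snell: the normal direction determines the refracted direction. -/
lemma snell_unique {κ : ℝ} (hκ0 : 0 < κ) {y m₁ m₂ : E} {l : ℝ}
    (h1 : ‖m₁‖ = 1) (h2 : ‖m₂‖ = 1)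
    (hm1 : κ ≤ ⟪m₁, y⟫) (hm2 : κ ≤ ⟪m₂, y⟫)
    (hl : 0 < l) (hg : y - κ • m₁ = l • (y - κ • m₂)) (hne : y - κ • m₂ ≠ 0) : m₁ = m₂ := by
  set w := y - κ • m₂ with hw
  have e : κ • (m₂ - m₁) = (l - 1) • w := by
    rw [sub_smul, ← hg, hw]; rw [smul_sub, one_smul]; abel
  have hsum : ⟪m₁ + m₂, m₂ - m₁⟫ = 0 := by
    rw [inner_add_left, inner_sub_right, inner_sub_right, real_inner_self_eq_norm_sq,
      real_inner_self_eq_norm_sq, h1, h2, real_inner_comm]; ring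
  have a2 : 0 ≤ ⟪m₂, w⟫ := by
    rw [hw, inner_sub_right, inner_smul_right, real_inner_self_eq_norm_sq, h2]; simp; linarith
  have a1 : 0 ≤ ⟪m₁, w⟫ := by
    have : 0 ≤ ⟪m₁, l • w⟫ := by
      rw [← hg, inner_sub_right, inner_smul_right, real_inner_self_eq_norm_sq, h1]; simp; linarith
    rw [inner_smul_right] at this
    exact nonneg_of_mul_nonneg_right this hl
  have hww : 0 < ⟪w, w⟫ := real_inner_self_pos.mpr hne
  have b1 : (l - 1) * (⟪m₁, w⟫ + ⟪m₂, w⟫) = 0 := by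
    have : ⟪m₁ + m₂, κ • (m₂ - m₁)⟫ = 0 := by rw [inner_smul_right, hsum, mul_zero]
    rw [e, inner_smul_right, inner_add_left] at this
    exact this
  have hl1 : l - 1 = 0 := by
    rcases mul_eq_zero.1 b1 with h | h
    · exact h
    · have c1 : ⟪m₁, w⟫ = 0 := by linarith
      have c2 : ⟪m₂, w⟫ = 0 := by linarith
      have : ⟪κ • (m₂ - m₁), w⟫ = 0 := by
        rw [real_inner_smul_left, inner_sub_left, c1, c2]; simp
      rw [e, real_inner_smul_left] at this
      rcases mul_eq_zero.1 this with h | h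
      · exact h
      · exact absurd h hww.ne'
  rw [hl1, zero_smul] at e
  rcases smul_eq_zero.1 e with h | h
  · exact absurd h hκ0.ne'
  · exact (sub_eq_zero.1 h).symm

lemma hasDerivAt_norm_curve {γ : ℝ → E} {γ' : E} {t : ℝ} (h : HasDerivAt γ γ' t) (h0 : γ t ≠ 0) :
    HasDerivAt (fun s => ‖γ s‖) (⟪γ t, γ'⟫ / ‖γ t‖) t := by
  have h1 := h.norm_sq
  have h2 := h1.sqrt (by simpa using h0)
  have h3 : (fun s => √(‖γ s‖ ^ 2)) = fun s => ‖γ s‖ := by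
    funext s; exact Real.sqrt_sq (norm_nonneg _)
  have h4 : 2 * ⟪γ t, γ'⟫ / (2 * √(‖γ t‖ ^ 2)) = ⟪γ t, γ'⟫ / ‖γ t‖ := by
    rw [Real.sqrt_sq (norm_nonneg _)]
    rw [mul_div_mul_left _ _ two_ne_zero]
  rw [h4] at h2
  exact h3 ▸ h2

lemma normalize_lip {z z' : E} (hz : 1 ≤ ‖z‖) (hz' : 1 ≤ ‖z'‖) :
    ‖‖z‖⁻¹ • z - ‖z'‖⁻¹ • z'‖ ≤ 2 * ‖z - z'‖ := by
  have p1 : 0 < ‖z‖ := by linarith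
  have p2 : 0 < ‖z'‖ := by linarith
  have e : ‖z‖⁻¹ • z - ‖z'‖⁻¹ • z' = ‖z‖⁻¹ • (z - z') + (‖z‖⁻¹ - ‖z'‖⁻¹) • z' := by
    rw [smul_sub, sub_smul]; abel
  have h1 : ‖‖z‖⁻¹ • (z - z')‖ ≤ ‖z - z'‖ := by
    rw [norm_smul, norm_inv, norm_norm]
    have : ‖z‖⁻¹ ≤ 1 := inv_le_one_of_one_le₀ hz
    nlinarith [norm_nonneg (z - z')]
  have h2 : ‖(‖z‖⁻¹ - ‖z'‖⁻¹) • z'‖ ≤ ‖z - z'‖ := by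
    rw [norm_smul]
    have e2 : ‖z‖⁻¹ - ‖z'‖⁻¹ = ‖z‖⁻¹ * (‖z'‖ - ‖z‖) * ‖z'‖⁻¹ := by field_simp
    rw [e2, norm_mul, norm_mul, norm_inv, norm_inv, norm_norm, norm_norm, mul_assoc,
      inv_mul_cancel₀ p2.ne', mul_one]
    have : ‖z‖⁻¹ ≤ 1 := inv_le_one_of_one_le₀ hz
    have h3 : ‖‖z'‖ - ‖z‖‖ ≤ ‖z - z'‖ := by
      rw [norm_sub_rev]; exact abs_norm_sub_norm_le z z'
    nlinarith [norm_nonneg (‖z'‖ - ‖z‖)]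
  rw [e]
  linarith [norm_add_le (‖z‖⁻¹ • (z - z')) ((‖z‖⁻¹ - ‖z'‖⁻¹) • z')]

end Geometry

/-- `y` maximizes the cost of the surface `ρ` with respect to the focus `P`. -/
def IsArgmax {n : ℕ} (κ : ℝ) (Ω : Set (EuclideanSpace ℝ (Fin n)))
    (ρ : EuclideanSpace ℝ (Fin n) → ℝ) (P y : EuclideanSpace ℝ (Fin n)) : Prop :=
  ∀ x ∈ closure Ω, ovCost κ P x (ρ x) ≤ ovCost κ P y (ρ y)

section NullStep
variable {E : Type*} [NormedAddCommGroup E] [InnerProductSpace ℝ E]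

lemma null_deriv {κ : ℝ} {e : E} {w0 : (ℝ ∙ e)ᗮ} {α : (ℝ ∙ e)ᗮ → ℝ}
    {α' : (ℝ ∙ e)ᗮ →L[ℝ] ℝ} (hα : HasFDerivAt α α' w0) {P X : E}
    (hX : X = α w0 • (e + (w0 : E))) (hX0 : X ≠ 0) (hXP : X ≠ P)
    (hmax : IsLocalMax (fun w : (ℝ ∙ e)ᗮ => ‖α w • (e + (w : E))‖
      + κ * ‖α w • (e + (w : E)) - P‖) w0) (u : (ℝ ∙ e)ᗮ) :
    ⟪‖X‖⁻¹ • X - κ • (‖P - X‖⁻¹ • (P - X)), α' u • (e + (w0 : E)) + α w0 • (u : E)⟫ = 0 := by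
  have hc : HasDerivAt (fun t : ℝ => w0 + t • u) u 0 := by
    simpa using ((hasDerivAt_id (0 : ℝ)).smul_const u).const_add w0
  have hc' : HasDerivAt (fun t : ℝ => e + ((w0 + t • u : (ℝ ∙ e)ᗮ) : E)) (u : E) 0 := by
    have := ((hasDerivAt_id (0 : ℝ)).smul_const (u : E)).const_add (e + (w0 : E))
    simpa [add_assoc] using this
  have hα0 : HasFDerivAt α α' (w0 + (0 : ℝ) • u) := by simpa using hα
  have h1 : HasDerivAt (fun t : ℝ => α (w0 + t • u)) (α' u) 0 := hα0.comp_hasDerivAt (0 : ℝ) hc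
  set γ : ℝ → E := fun t => α (w0 + t • u) • (e + ((w0 + t • u : (ℝ ∙ e)ᗮ) : E)) with hγ
  have hγ0 : γ 0 = X := by simp [hγ, hX]
  set γ' : E := α' u • (e + (w0 : E)) + α w0 • (u : E) with hγ'
  have h2 : HasDerivAt γ γ' 0 := by
    have := h1.smul hc'
    simp only [zero_smul, add_zero] at this
    rw [hγ', add_comm]
    exact this
  have h3 := hasDerivAt_norm_curve h2 (by rw [hγ0]; exact hX0)
  have h4 := hasDerivAt_norm_curve (h2.sub_const P) (by rw [hγ0]; exact sub_ne_zero.2 hXP)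
  have h5 := h3.add (h4.const_mul κ)
  have hm : IsLocalMax (fun t : ℝ => ‖γ t‖ + κ * ‖γ t - P‖) 0 := by
    have hcont : Filter.Tendsto (fun t : ℝ => w0 + t • u) (nhds 0) (nhds w0) := by
      have := hc.continuousAt
      unfold ContinuousAt at this
      simpa using this
    have := hcont.eventually hmax
    filter_upwards [this] with t ht
    simpa [hγ] using ht
  have h6 := hm.hasDerivAt_eq_zero h5
  rw [hγ0] at h6
  rw [inner_sub_left, real_inner_smul_left, real_inner_smul_left, real_inner_smul_left]
  have h7 : ⟪P - X, γ'⟫ = - ⟪X - P, γ'⟫ := by rw [← inner_neg_left, neg_sub]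
  rw [h7, norm_sub_rev P X, ← h6]
  ring

lemma null_step {κ : ℝ} (hκ0 : 0 < κ) (hκ1 : κ < 1) {e : E} {w0 : (ℝ ∙ e)ᗮ} {α : (ℝ ∙ e)ᗮ → ℝ}
    (hα : DifferentiableAt ℝ α w0) (hα0 : 0 < α w0) {P₁ P₂ X y m₁ m₂ : E} {c : ℝ}
    (hX : X = α w0 • (e + (w0 : E))) (hy : ‖y‖ = 1) (hc : 0 < c) (hcy : e + (w0 : E) = c • y)
    (hXP₁ : X ≠ P₁) (hXP₂ : X ≠ P₂)
    (hmax₁ : IsLocalMax (fun w : (ℝ ∙ e)ᗮ => ‖α w • (e + (w : E))‖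
      + κ * ‖α w • (e + (w : E)) - P₁‖) w0)
    (hmax₂ : IsLocalMax (fun w : (ℝ ∙ e)ᗮ => ‖α w • (e + (w : E))‖
      + κ * ‖α w • (e + (w : E)) - P₂‖) w0)
    (hm₁ : m₁ = ‖P₁ - X‖⁻¹ • (P₁ - X)) (hm₂ : m₂ = ‖P₂ - X‖⁻¹ • (P₂ - X))
    (hk₁ : κ ≤ ⟪m₁, y⟫) (hk₂ : κ ≤ ⟪m₂, y⟫) : m₁ = m₂ := by
  have hXy : X = (α w0 * c) • y := by rw [hX, hcy, smul_smul]
  have hac : 0 < α w0 * c := mul_pos hα0 hc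
  have hX0 : X ≠ 0 := by
    rw [hXy]; exact smul_ne_zero hac.ne' (by intro h; simp [h] at hy)
  have hXn : ‖X‖⁻¹ • X = y := by
    rw [hXy, norm_smul, hy, mul_one, Real.norm_of_nonneg hac.le, smul_smul,
      inv_mul_cancel₀ hac.ne', one_smul]
  have n1 : ‖m₁‖ = 1 := by
    rw [hm₁]; exact norm_smul_inv_norm (𝕜 := ℝ) (sub_ne_zero.2 hXP₁.symm)
  have n2 : ‖m₂‖ = 1 := by
    rw [hm₂]; exact norm_smul_inv_norm (𝕜 := ℝ) (sub_ne_zero.2 hXP₂.symm)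
  obtain ⟨α', hα'⟩ := hα
  have d1 := null_deriv hα' hX hX0 hXP₁ hmax₁
  have d2 := null_deriv hα' hX hX0 hXP₂ hmax₂
  rw [hXn, ← hm₁] at d1
  rw [hXn, ← hm₂] at d2
  set g₁ := y - κ • m₁
  set g₂ := y - κ • m₂
  have pos : ∀ m : E, ‖m‖ = 1 → 0 < ⟪y - κ • m, y⟫ := by
    intro m hm
    rw [inner_sub_left, real_inner_smul_left, real_inner_self_eq_norm_sq, hy]
    have := real_inner_le_norm m y
    rw [hm, hy] at this
    nlinarith
  have p1 : 0 < ⟪g₁, y⟫ := pos m₁ n1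
  have p2 : 0 < ⟪g₂, y⟫ := pos m₂ n2
  set d := ⟪g₂, y⟫ • g₁ - ⟪g₁, y⟫ • g₂ with hd
  have dy : ⟪d, y⟫ = 0 := by
    rw [hd, inner_sub_left, real_inner_smul_left, real_inner_smul_left]; ring
  have du : ∀ u : (ℝ ∙ e)ᗮ, ⟪d, (u : E)⟫ = 0 := by
    intro u
    have a1 := d1 u
    have a2 := d2 u
    rw [inner_add_right, inner_smul_right, inner_smul_right, hcy, inner_smul_right] at a1 a2
    rw [hd, inner_sub_left, real_inner_smul_left, real_inner_smul_left]
    have : α w0 * (⟪g₂, y⟫ * ⟪g₁, (u : E)⟫ - ⟪g₁, y⟫ * ⟪g₂, (u : E)⟫) = 0 := by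
      linear_combination ⟪g₂, y⟫ * a1 - ⟪g₁, y⟫ * a2
    rcases mul_eq_zero.1 this with h | h
    · exact absurd h hα0.ne'
    · exact h
  have de : ⟪d, e⟫ = 0 := by
    have h1 : ⟪d, e + (w0 : E)⟫ = 0 := by rw [hcy, inner_smul_right, dy, mul_zero]
    rw [inner_add_right, du w0, add_zero] at h1
    exact h1
  have hdmem : d ∈ (ℝ ∙ e)ᗮ := by
    rw [Submodule.mem_orthogonal_singleton_iff_inner_left]; exact de
  have hd0 : d = 0 := by
    have := du ⟨d, hdmem⟩
    exact inner_self_eq_zero.1 this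
  have hg : g₁ = (⟪g₁, y⟫ / ⟪g₂, y⟫) • g₂ := by
    have : ⟪g₂, y⟫ • g₁ = ⟪g₁, y⟫ • g₂ := sub_eq_zero.1 hd0
    rw [div_eq_inv_mul, mul_smul, ← this, smul_smul, inv_mul_cancel₀ p2.ne', one_smul]
  refine snell_unique hκ0 n1 n2 hk₁ hk₂ (div_pos p1 p2) hg ?_
  intro h
  have : ⟪g₂, y⟫ = 0 := by
    change ⟪y - κ • m₂, y⟫ = 0
    rw [h, inner_zero_left]
  exact p2.ne' this

end NullStep

/-- Almost every point refracts to at most one focus. -/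
lemma null_set {n : ℕ} (hn : 2 ≤ n) {κ τ r₀ : ℝ} (hκ0 : 0 < κ) (hκ1 : κ < 1)
    (hττ : τ < 1 - κ) (hτ0 : 0 < τ)
    {Ω D : Set (EuclideanSpace ℝ (Fin n))}
    (hΩsph : Ω ⊆ Metric.sphere 0 1)
    (hΩopen : ∃ U : Set (EuclideanSpace ℝ (Fin n)), IsOpen U ∧ Ω = U ∩ Metric.sphere 0 1)
    (hD0 : (0 : EuclideanSpace ℝ (Fin n)) ∉ D)
    (hH1 : ∀ x ∈ closure Ω, ∀ P ∈ D, (κ + τ) * ‖P‖ ≤ ⟪x, P⟫)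
    (hr : ∀ P ∈ D, (1 + κ) * r₀ ≤ τ * ‖P‖)
    (hH2 : ∀ X ∈ coneQ Ω r₀, ∀ m : EuclideanSpace ℝ (Fin n), ‖m‖ = 1 →
      (D ∩ {Z | ∃ t : ℝ, 0 ≤ t ∧ Z = X + t • m}).Subsingleton)
    {ρ : EuclideanSpace ℝ (Fin n) → ℝ} {L : NNReal} (hlip : LipschitzOnWith L ρ (closure Ω))
    (hρ : ∀ x ∈ closure Ω, 0 < ρ x ∧ ρ x ≤ r₀) :
    sphereMeasure n {y | y ∈ Ω ∧ ∃ P₁ ∈ D, ∃ P₂ ∈ D, P₁ ≠ P₂ ∧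
      IsArgmax κ Ω ρ P₁ y ∧ IsArgmax κ Ω ρ P₂ y} = 0 := by
  obtain ⟨U, hU, hΩU⟩ := hΩopen
  set S := {y | y ∈ Ω ∧ ∃ P₁ ∈ D, ∃ P₂ ∈ D, P₁ ≠ P₂ ∧
      IsArgmax κ Ω ρ P₁ y ∧ IsArgmax κ Ω ρ P₂ y} with hS
  refine le_antisymm ((Measure.restrict_apply_le _ _).trans (le_of_eq ?_)) zero_le
  apply measure_null_of_locally_null
  intro e he
  have heΩ : e ∈ Ω := he.1
  have hen : ‖e‖ = 1 := by simpa using hΩsph heΩ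
  have he0 : e ≠ 0 := by intro h; simp [h] at hen
  have hopen : IsOpen {y : EuclideanSpace ℝ (Fin n) | 0 < ⟪y, e⟫} :=
    isOpen_lt continuous_const (by fun_prop)
  refine ⟨S ∩ {y | 0 < ⟪y, e⟫}, Filter.inter_mem self_mem_nhdsWithin
    (mem_nhdsWithin_of_mem_nhds (hopen.mem_nhds ?_)), ?_⟩
  · change 0 < ⟪e, e⟫
    rw [real_inner_self_eq_norm_sq, hen]; norm_num
  -- the chart
  obtain ⟨ρ', hρ'lip, hρ'eq⟩ := hlip.extend_real
  set G : (ℝ ∙ e)ᗮ → EuclideanSpace ℝ (Fin n) := fun w =>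
    ‖e + (w : EuclideanSpace ℝ (Fin n))‖⁻¹ • (e + (w : EuclideanSpace ℝ (Fin n))) with hG
  have horth : ∀ w : (ℝ ∙ e)ᗮ, ⟪e, (w : EuclideanSpace ℝ (Fin n))⟫ = 0 := by
    intro w
    exact (Submodule.mem_orthogonal_singleton_iff_inner_right).1 w.2
  have hnorm : ∀ w : (ℝ ∙ e)ᗮ, 1 ≤ ‖e + (w : EuclideanSpace ℝ (Fin n))‖ := by
    intro w
    have h1 : ‖e + (w : EuclideanSpace ℝ (Fin n))‖ ^ 2 = 1 + ‖(w : EuclideanSpace ℝ (Fin n))‖ ^ 2 := by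
      rw [norm_add_sq_real, horth, hen]; ring
    have h2 : 1 ≤ ‖e + (w : EuclideanSpace ℝ (Fin n))‖ ^ 2 := by
      rw [h1]; nlinarith [sq_nonneg ‖(w : EuclideanSpace ℝ (Fin n))‖]
    nlinarith [norm_nonneg (e + (w : EuclideanSpace ℝ (Fin n)))]
  have hne : ∀ w : (ℝ ∙ e)ᗮ, e + (w : EuclideanSpace ℝ (Fin n)) ≠ 0 := by
    intro w h
    have := hnorm w
    rw [h, norm_zero] at this
    linarith
  have hGn : ∀ w, ‖G w‖ = 1 := fun w => norm_smul_inv_norm (𝕜 := ℝ) (hne w)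
  have hGlip : LipschitzWith 2 G := by
    apply LipschitzWith.of_dist_le_mul
    intro w w'
    rw [dist_eq_norm, dist_eq_norm]
    have := normalize_lip (hnorm w) (hnorm w')
    refine this.trans (le_of_eq ?_)
    congr 1
    rw [add_sub_add_left_eq_sub]
    rfl
  have hcomp := hρ'lip.comp hGlip
  have hfin : Module.finrank ℝ (ℝ ∙ e)ᗮ = n - 1 := by
    have : Fact (Module.finrank ℝ (EuclideanSpace ℝ (Fin n)) = (n - 1) + 1) :=
      ⟨by rw [finrank_euclideanSpace_fin]; omega⟩
    exact Submodule.finrank_orthogonal_span_singleton he0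
  have hdim : ((Module.finrank ℝ (ℝ ∙ e)ᗮ : ℕ) : ℝ) = (n : ℝ) - 1 := by
    rw [hfin, Nat.cast_sub (by omega)]; simp
  have hae := hcomp.ae_differentiableAt (μ := (μH[Module.finrank ℝ (ℝ ∙ e)ᗮ] : Measure (ℝ ∙ e)ᗮ))
  set A := {w : (ℝ ∙ e)ᗮ | ¬ DifferentiableAt ℝ (ρ' ∘ G) w} with hA
  have hA0 : (μH[Module.finrank ℝ (ℝ ∙ e)ᗮ] : Measure (ℝ ∙ e)ᗮ) A = 0 := hae
  have himg : μH[(n : ℝ) - 1] (G '' A) = 0 := by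
    have := hGlip.hausdorffMeasure_image_le (d := (n : ℝ) - 1)
      (by rw [← hdim]; positivity) A
    rw [← hdim, hA0, mul_zero] at this
    rw [← hdim]
    exact le_antisymm this zero_le
  refine measure_mono_null ?_ himg
  rintro y ⟨⟨hyΩ, P₁, hP₁, P₂, hP₂, hne12, hA1, hA2⟩, hye⟩
  have hyn : ‖y‖ = 1 := by simpa using hΩsph hyΩ
  change 0 < ⟪y, e⟫ at hye
  have hycl : y ∈ closure Ω := subset_closure hyΩ
  -- preimage of `y`
  set c := ⟪y, e⟫⁻¹ with hc
  have hcpos : 0 < c := inv_pos.2 hye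
  have hwmem : c • y - e ∈ (ℝ ∙ e)ᗮ := by
    rw [Submodule.mem_orthogonal_singleton_iff_inner_left, inner_sub_left, real_inner_smul_left,
      real_inner_self_eq_norm_sq, hen, hc, inv_mul_cancel₀ hye.ne']; norm_num
  set w0 : (ℝ ∙ e)ᗮ := ⟨c • y - e, hwmem⟩ with hw0
  have hcy : e + (w0 : EuclideanSpace ℝ (Fin n)) = c • y := by simp [hw0]
  have hGw0 : G w0 = y := by
    simp only [hG]
    rw [hcy, norm_smul, hyn, mul_one, Real.norm_of_nonneg hcpos.le, smul_smul,
      inv_mul_cancel₀ hcpos.ne', one_smul]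
  refine ⟨w0, ?_, hGw0⟩
  intro hdiff
  -- derive a contradiction
  set α : (ℝ ∙ e)ᗮ → ℝ := fun w => ρ' (G w) * ‖e + (w : EuclideanSpace ℝ (Fin n))‖⁻¹ with hα
  have hαd : DifferentiableAt ℝ α w0 := by
    have h1 : DifferentiableAt ℝ (fun w : (ℝ ∙ e)ᗮ => e + (w : EuclideanSpace ℝ (Fin n))) w0 :=
      ((ℝ ∙ e)ᗮ.subtypeL.differentiableAt).const_add e
    have h2 := (h1.norm ℝ (hne w0)).inv (norm_ne_zero_iff.2 (hne w0))
    exact hdiff.mul h2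
  have hαs : ∀ w, α w • (e + (w : EuclideanSpace ℝ (Fin n))) = ρ' (G w) • G w := by
    intro w; simp only [hα, hG, smul_smul]
  have hρy : ρ' y = ρ y := (hρ'eq hycl).symm
  obtain ⟨hρ0, hρr⟩ := hρ y hycl
  have hα0 : 0 < α w0 := by
    simp only [hα]
    rw [hGw0, hρy]
    exact mul_pos hρ0 (inv_pos.2 (norm_pos_iff.2 (hne w0)))
  set X := ρ y • y with hX
  have hXα : X = α w0 • (e + (w0 : EuclideanSpace ℝ (Fin n))) := by rw [hαs, hGw0, hρy]
  have hXn : ‖X‖ = ρ y := by rw [hX, norm_smul, hyn, mul_one, Real.norm_of_nonneg hρ0.le]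
  have hPpos : ∀ P ∈ D, 0 < ‖P‖ := fun P hP => norm_pos_iff.2 (fun h => hD0 (h ▸ hP))
  have hXP : ∀ P ∈ D, X ≠ P := by
    intro P hP h
    have h1 := hr P hP
    have h2 := hPpos P hP
    rw [← h, hXn] at h1 h2
    nlinarith
  have hmax : ∀ P, IsArgmax κ Ω ρ P y → IsLocalMax (fun w : (ℝ ∙ e)ᗮ =>
      ‖α w • (e + (w : EuclideanSpace ℝ (Fin n)))‖
      + κ * ‖α w • (e + (w : EuclideanSpace ℝ (Fin n))) - P‖) w0 := by
    intro P hP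
    have hyU : G w0 ∈ U := by rw [hGw0]; rw [hΩU] at hyΩ; exact hyΩ.1
    have hev : ∀ᶠ w in nhds w0, G w ∈ U := hGlip.continuous.continuousAt.eventually
      (hU.mem_nhds hyU)
    have hval : ∀ w, G w ∈ Ω → ‖α w • (e + (w : EuclideanSpace ℝ (Fin n)))‖
      + κ * ‖α w • (e + (w : EuclideanSpace ℝ (Fin n))) - P‖ = ovCost κ P (G w) (ρ (G w)) := by
      intro w hw
      have hcl := subset_closure hw
      have e1 : ρ' (G w) = ρ (G w) := (hρ'eq hcl).symm
      rw [hαs, e1, norm_smul, hGn, mul_one, Real.norm_of_nonneg (hρ _ hcl).1.le, ovCost]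
    filter_upwards [hev] with w hw
    have hwΩ : G w ∈ Ω := by rw [hΩU]; exact ⟨hw, by simpa using hGn w⟩
    rw [hval w hwΩ, hval w0 (by rw [hGw0]; exact hyΩ), hGw0]
    exact hP _ (subset_closure hwΩ)
  have hmk : ∀ P ∈ D, κ ≤ ⟪‖P - X‖⁻¹ • (P - X), y⟫ := by
    intro P hP
    have hpos : 0 < ‖P - X‖ := norm_pos_iff.2 (sub_ne_zero.2 (hXP P hP).symm)
    rw [real_inner_smul_left, ← div_eq_inv_mul, le_div_iff₀ hpos, inner_sub_left, hX,
      real_inner_smul_left, real_inner_self_eq_norm_sq, hyn, ← hX, real_inner_comm]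
    have h1 := hH1 y hycl P hP
    have h2 := hr P hP
    have h3 := norm_sub_le P X
    rw [hXn] at h3
    nlinarith
  have hmeq := null_step hκ0 hκ1 hαd hα0 hXα hyn hcpos hcy (hXP P₁ hP₁) (hXP P₂ hP₂)
    (hmax P₁ hA1) (hmax P₂ hA2) rfl rfl (hmk P₁ hP₁) (hmk P₂ hP₂)
  set m := ‖P₁ - X‖⁻¹ • (P₁ - X) with hm
  have hmn : ‖m‖ = 1 := norm_smul_inv_norm (𝕜 := ℝ) (sub_ne_zero.2 (hXP P₁ hP₁).symm)
  have hXQ : X ∈ coneQ Ω r₀ := ⟨y, hycl, ρ y, hρ0, hρr, rfl⟩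
  have hray : ∀ P ∈ D, m = ‖P - X‖⁻¹ • (P - X) →
      P ∈ D ∩ {Z | ∃ t : ℝ, 0 ≤ t ∧ Z = X + t • m} := by
    intro P hP h
    have hpos : 0 < ‖P - X‖ := norm_pos_iff.2 (sub_ne_zero.2 (hXP P hP).symm)
    refine ⟨hP, ‖P - X‖, norm_nonneg _, ?_⟩
    rw [h, smul_smul, mul_inv_cancel₀ hpos.ne', one_smul]; abel
  exact hne12 (hH2 X hXQ m hmn (hray P₁ hP₁ hm) (hray P₂ hP₂ hmeq))

section MeasureAux
variable {α : Type*} [MeasurableSpace α]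

lemma le_measure_of_frequently {l : Measure α} [IsFiniteMeasure l] {A : ℕ → Set α} {B : Set α}
    (hA : ∀ k, MeasurableSet (A k)) (h : ∀ x, (∃ᶠ k in Filter.atTop, x ∈ A k) → x ∈ B)
    {w : ENNReal} (hw : ∀ k, w ≤ l (A k)) : w ≤ l B := by
  set T : ℕ → Set α := fun N => ⋃ k, A (N + k) with hT
  have hanti : Antitone T := by
    intro N M hNM x hx
    obtain ⟨k, hk⟩ := Set.mem_iUnion.1 hx
    refine Set.mem_iUnion.2 ⟨M - N + k, ?_⟩
    have : N + (M - N + k) = M + k := by omega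
    rw [this]; exact hk
  have ht := tendsto_measure_iInter_atTop (μ := l) (s := T)
    (fun N => (MeasurableSet.iUnion fun k => hA _).nullMeasurableSet) hanti
    ⟨0, measure_ne_top _ _⟩
  have h1 : w ≤ l (⋂ N, T N) := by
    refine ge_of_tendsto' ht fun N => (hw N).trans (measure_mono ?_)
    intro x hx
    exact Set.mem_iUnion.2 ⟨0, hx⟩
  refine h1.trans (measure_mono ?_)
  intro x hx
  apply h
  rw [Filter.frequently_atTop]
  intro N
  obtain ⟨k, hk⟩ := Set.mem_iUnion.1 (Set.mem_iInter.1 hx N)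
  exact ⟨N + k, by omega, hk⟩

lemma measure_le_of_eventually {l : Measure α} {A : ℕ → Set α} {B : Set α}
    (h : ∀ x ∈ B, ∀ᶠ k in Filter.atTop, x ∈ A k)
    {w : ENNReal} (hw : ∀ k, l (A k) ≤ w) : l B ≤ w := by
  set T : ℕ → Set α := fun N => ⋂ k, A (N + k) with hT
  have hmono : Monotone T := by
    intro N M hNM x hx
    refine Set.mem_iInter.2 fun k => ?_
    have := Set.mem_iInter.1 hx (M - N + k)
    have e : N + (M - N + k) = M + k := by omega
    rwa [e] at this
  have ht := tendsto_measure_iUnion_atTop (μ := l) hmono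
  have h1 : l (⋃ N, T N) ≤ w := by
    refine le_of_tendsto' ht fun N => (measure_mono ?_).trans (hw N)
    intro x hx
    exact Set.mem_iInter.1 hx 0
  refine (measure_mono ?_).trans h1
  intro x hx
  obtain ⟨N, hN⟩ := Filter.eventually_atTop.1 (h x hx)
  exact Set.mem_iUnion.2 ⟨N, Set.mem_iInter.2 fun k => hN _ (by omega)⟩

end MeasureAux

lemma continuous_ovalH {n : ℕ} (κ : ℝ) (P : EuclideanSpace ℝ (Fin n)) :
    Continuous fun q : ℝ × EuclideanSpace ℝ (Fin n) => ovalH κ q.1 P q.2 := by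
  unfold ovalH ovalDelta
  fun_prop

/-- A surface supported everywhere is Lipschitz. -/
lemma refractor_lip {n : ℕ} {κ r₀ : ℝ} (hκ0 : 0 < κ) (hκ1 : κ < 1)
    {Ω : Set (EuclideanSpace ℝ (Fin n))} (hΩn : ∀ x ∈ closure Ω, ‖x‖ = 1)
    {ρ : EuclideanSpace ℝ (Fin n) → ℝ}
    (hρ : ∀ x ∈ closure Ω, 0 < ρ x ∧ ρ x ≤ r₀)
    (hs : ∀ y ∈ closure Ω, ∃ P, IsArgmax κ Ω ρ P y) :
    LipschitzOnWith (Real.toNNReal (κ * r₀ / (1 - κ))) ρ (closure Ω) := by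
  have main : ∀ x ∈ closure Ω, ∀ y ∈ closure Ω, ρ x ≤ ρ y + κ * r₀ / (1 - κ) * ‖x - y‖ := by
    intro x hx y hy
    have hr0 : 0 < r₀ := (hρ x hx).1.trans_le (hρ x hx).2
    have hk : 0 < 1 - κ := by linarith
    by_cases hxy : ρ x ≤ ρ y
    · have : 0 ≤ κ * r₀ / (1 - κ) * ‖x - y‖ := by positivity
      linarith
    push Not at hxy
    obtain ⟨P, hP⟩ := hs y hy
    have h1 := hP x hx
    unfold ovCost at h1
    have h2 : ‖ρ y • y - P‖ ≤ ‖ρ x • x - P‖ + ((ρ x - ρ y) + ρ y * ‖x - y‖) := by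
      have e : ρ y • y - P = (ρ x • x - P) + (-((ρ x - ρ y) • x) + -(ρ y • (x - y))) := by
        rw [sub_smul, smul_sub]; abel
      rw [e]
      refine (norm_add_le _ _).trans (add_le_add_right ?_ _)
      refine (norm_add_le _ _).trans (le_of_eq ?_)
      rw [norm_neg, norm_neg, norm_smul, norm_smul, hΩn x hx, Real.norm_of_nonneg (by linarith),
        Real.norm_of_nonneg (hρ y hy).1.le, mul_one]
    have h3 : ρ y * ‖x - y‖ ≤ r₀ * ‖x - y‖ :=
      mul_le_mul_of_nonneg_right (hρ y hy).2 (norm_nonneg _)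
    have h4 : (1 - κ) * (ρ x - ρ y) ≤ κ * r₀ * ‖x - y‖ := by nlinarith
    have h5 : ρ x - ρ y ≤ κ * r₀ * ‖x - y‖ / (1 - κ) := by
      rw [le_div_iff₀ hk]; linarith
    have h6 : κ * r₀ * ‖x - y‖ / (1 - κ) = κ * r₀ / (1 - κ) * ‖x - y‖ := by ring
    linarith
  apply LipschitzOnWith.of_dist_le_mul
  intro x hx y hy
  have hr0 : 0 < r₀ := (hρ x hx).1.trans_le (hρ x hx).2
  rw [Real.coe_toNNReal _ (div_nonneg (by positivity) (by linarith)), Real.dist_eq, dist_eq_norm,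
    abs_le]
  have h1 := main x hx y hy
  have h2 := main y hy x hx
  rw [norm_sub_rev] at h2
  constructor <;> linarith

/-- The cell of the `i`-th focus. -/
def cellV {n : ℕ} {ι : Type*} (κ : ℝ) (Ω : Set (EuclideanSpace ℝ (Fin n)))
    (P : ι → EuclideanSpace ℝ (Fin n)) (i : ι) (b : ι → ℝ) : Set (EuclideanSpace ℝ (Fin n)) :=
  {x | x ∈ closure Ω ∧ ∀ j, ovalH κ (b i) (P i) x ≤ ovalH κ (b j) (P j) x}

lemma isClosed_cellV {n : ℕ} {ι : Type*} (κ : ℝ) (Ω : Set (EuclideanSpace ℝ (Fin n)))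
    (P : ι → EuclideanSpace ℝ (Fin n)) (i : ι) (b : ι → ℝ) : IsClosed (cellV κ Ω P i b) := by
  have e : cellV κ Ω P i b = closure Ω ∩ ⋂ j, {x | ovalH κ (b i) (P i) x ≤ ovalH κ (b j) (P j) x} := by
    ext x; simp [cellV]
  rw [e]
  refine isClosed_closure.inter (isClosed_iInter fun j => ?_)
  refine isClosed_le ?_ ?_
  · exact (continuous_ovalH κ (P i)).comp (by fun_prop : Continuous fun x => (b i, x))
  · exact (continuous_ovalH κ (P j)).comp (by fun_prop : Continuous fun x => (b j, x))

lemma discrete_refractor {n : ℕ} {κ τ r₀ : ℝ} (hκ0 : 0 < κ) (hκ1 : κ < 1)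
    (hττ : τ < 1 - κ)
    {Ω D : Set (EuclideanSpace ℝ (Fin n))} (hΩn : ∀ x ∈ closure Ω, ‖x‖ = 1)
    (hD0 : (0 : EuclideanSpace ℝ (Fin n)) ∉ D)
    (hr : ∀ P ∈ D, (1 + κ) * r₀ ≤ τ * ‖P‖)
    (l : Measure (EuclideanSpace ℝ (Fin n))) [IsFiniteMeasure l]
    (hnull : ∀ (ρ : EuclideanSpace ℝ (Fin n) → ℝ),
      (∀ x ∈ closure Ω, 0 < ρ x ∧ ρ x ≤ r₀) → (∀ y ∈ closure Ω, ∃ P, IsArgmax κ Ω ρ P y) →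
      l {y | y ∈ closure Ω ∧ ∃ P₁ ∈ D, ∃ P₂ ∈ D, P₁ ≠ P₂ ∧
        IsArgmax κ Ω ρ P₁ y ∧ IsArgmax κ Ω ρ P₂ y} = 0)
    {x₀ : EuclideanSpace ℝ (Fin n)} (hx₀ : x₀ ∈ closure Ω) {s : ℝ} (hs0 : 0 < s)
    (hsr : (1 + κ) * s < (1 - κ) * r₀)
    {ι : Type*} [Fintype ι] [Nonempty ι] (P : ι → EuclideanSpace ℝ (Fin n))
    (hPD : ∀ i, P i ∈ D) (hPinj : Function.Injective P)
    (w : ι → ENNReal) (hw : ∑ i, w i = l (closure Ω)) :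
    ∃ ρ : EuclideanSpace ℝ (Fin n) → ℝ, (∀ x ∈ closure Ω, 0 < ρ x ∧ ρ x ≤ r₀) ∧ ρ x₀ = s ∧
      (∀ y ∈ closure Ω, ∃ i, IsArgmax κ Ω ρ (P i) y) ∧
      ∀ i, w i ≤ l {y | y ∈ closure Ω ∧ IsArgmax κ Ω ρ (P i) y} := by
  classical
  have hk : 0 < 1 - κ := by linarith
  have hr0 : 0 < r₀ := by
    by_contra h
    push Not at h
    nlinarith
  have hsr' : s < r₀ := by nlinarith
  have hPpos : ∀ i, 0 < ‖P i‖ := fun i => norm_pos_iff.2 (fun h => hD0 (h ▸ hPD i))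
  set c : ι → ℝ := fun i => ovCost κ (P i) x₀ s with hc
  set B : ι → ℝ := fun i => κ * ‖P i‖ + (1 + κ) * r₀ with hB
  have hcB : c ≤ B := by
    intro i
    have := ovCost_upper (P := P i) hκ0 (hΩn x₀ hx₀) hs0.le
    simp only [hc, hB]
    nlinarith
  have hclow : ∀ i, κ * ‖P i‖ < c i := by
    intro i
    have := ovCost_lower (P := P i) hκ0 (hΩn x₀ hx₀) hs0.le
    simp only [hc]
    nlinarith
  have hBup : ∀ i, B i < ‖P i‖ := by
    intro i
    have h1 := hr (P i) (hPD i)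
    have h2 := hPpos i
    simp only [hB]
    nlinarith
  have hrange : ∀ b ∈ Set.Icc c B, ∀ i, κ * ‖P i‖ < b i ∧ b i < ‖P i‖ := fun b hb i =>
    ⟨(hclow i).trans_le (hb.1 i), (hb.2 i).trans_lt (hBup i)⟩
  -- lower bound on h
  have hhpos : ∀ b ∈ Set.Icc c B, ∀ i, ∀ x ∈ closure Ω, 0 < ovalH κ (b i) (P i) x := by
    intro b hb i x hx
    obtain ⟨h1, h2⟩ := hrange b hb i
    set t := (b i - κ * ‖P i‖) / (1 + κ) with ht
    have ht0 : 0 < t := div_pos (by linarith) (by linarith)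
    have h3 : t ≤ ovalH κ (b i) (P i) x := by
      rw [le_ovalH_iff hκ0 hκ1 (hΩn x hx) h1 h2]
      refine (ovCost_upper hκ0 (hΩn x hx) ht0.le).trans (le_of_eq ?_)
      rw [ht]; field_simp; ring
    linarith
  have hhup : ∀ b ∈ Set.Icc c B, ∀ j, b j = c j → ∀ x ∈ closure Ω,
      ovalH κ (b j) (P j) x < r₀ := by
    intro b hb j hj x hx
    obtain ⟨h1, h2⟩ := hrange b hb j
    have h3 := ovCost_lower (P := P j) hκ0 (hΩn x hx) (hhpos b hb j x hx).le
    rw [ovCost_ovalH hκ0 hκ1 (hΩn x hx) h1 h2, hj] at h3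
    have h4 := ovCost_upper (P := P j) hκ0 (hΩn x₀ hx₀) hs0.le
    simp only [hc] at h3
    rw [hj]
    simp only [hc]
    by_contra hcon
    push Not at hcon
    nlinarith
  -- the surface associated with b
  set R : (ι → ℝ) → EuclideanSpace ℝ (Fin n) → ℝ := fun b x =>
    Finset.univ.inf' Finset.univ_nonempty (fun i => ovalH κ (b i) (P i) x) with hR
  have hRle : ∀ b x i, R b x ≤ ovalH κ (b i) (P i) x := fun b x i =>
    Finset.inf'_le _ (Finset.mem_univ i)
  have hRex : ∀ b x, ∃ i, R b x = ovalH κ (b i) (P i) x := by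
    intro b x
    obtain ⟨i, -, hi⟩ := Finset.exists_mem_eq_inf' (Finset.univ_nonempty (α := ι))
      (fun i => ovalH κ (b i) (P i) x)
    exact ⟨i, hi⟩
  have hRb : ∀ b ∈ Set.Icc c B, (∃ j, b j = c j) → ∀ x ∈ closure Ω, 0 < R b x ∧ R b x ≤ r₀ := by
    rintro b hb ⟨j, hj⟩ x hx
    constructor
    · obtain ⟨i, hi⟩ := hRex b x
      rw [hi]; exact hhpos b hb i x hx
    · exact (hRle b x j).trans (hhup b hb j hj x hx).le
  have hVR : ∀ b x i, x ∈ cellV κ Ω P i b → R b x = ovalH κ (b i) (P i) x := by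
    intro b x i hx
    obtain ⟨j, hj⟩ := hRex b x
    exact le_antisymm (hRle b x i) (hj ▸ hx.2 j)
  have hVarg : ∀ b ∈ Set.Icc c B, ∀ i, ∀ x ∈ cellV κ Ω P i b, IsArgmax κ Ω (R b) (P i) x := by
    intro b hb i x hx z hz
    obtain ⟨h1, h2⟩ := hrange b hb i
    rw [hVR b x i hx, ovCost_ovalH hκ0 hκ1 (hΩn x hx.1) h1 h2,
      ← le_ovalH_iff hκ0 hκ1 (hΩn z hz) h1 h2]
    exact hRle b z i
  have hVcov : ∀ b, ∀ x ∈ closure Ω, ∃ i, x ∈ cellV κ Ω P i b := by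
    intro b x hx
    obtain ⟨i, hi⟩ := hRex b x
    exact ⟨i, hx, fun j => hi ▸ hRle b x j⟩
  -- the admissible set
  set W : Set (ι → ℝ) := {b | b ∈ Set.Icc c B ∧ (∃ j, b j = c j) ∧
    ∀ i, c i < b i → w i ≤ l (cellV κ Ω P i b)} with hW
  have hWclosed : IsClosed W := by
    have e : W = Set.Icc c B ∩ ((⋃ j, {b | b j = c j}) ∩
        ⋂ i, {b | c i < b i → w i ≤ l (cellV κ Ω P i b)}) := by
      ext b; simp [hW, Set.mem_iUnion, Set.mem_iInter]
    rw [e]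
    refine isClosed_Icc.inter (IsClosed.inter ?_ (isClosed_iInter fun i => ?_))
    · exact isClosed_iUnion_of_finite fun j => isClosed_eq (continuous_apply j) continuous_const
    · apply IsSeqClosed.isClosed
      intro u b hu hub hcb
      have hubi : Filter.Tendsto (fun k => u k i) Filter.atTop (nhds (b i)) :=
        (tendsto_pi_nhds.1 hub) i
      obtain ⟨N, hN⟩ := Filter.eventually_atTop.1 (hubi.eventually (lt_mem_nhds hcb))
      have hub' : Filter.Tendsto (fun k => u (k + N)) Filter.atTop (nhds b) :=
        hub.comp (Filter.tendsto_add_atTop_nat N)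
      refine le_measure_of_frequently (A := fun k => cellV κ Ω P i (u (k + N)))
        (fun k => (isClosed_cellV _ _ _ _ _).measurableSet) ?_
        (fun k => hu (k + N) (hN _ (by omega)))
      intro x hx
      refine ⟨?_, fun j => ?_⟩
      · obtain ⟨k, hk⟩ := hx.exists
        exact hk.1
      · have hcl : IsClosed {b : ι → ℝ | ovalH κ (b i) (P i) x ≤ ovalH κ (b j) (P j) x} := by
          refine isClosed_le ?_ ?_
          · exact (continuous_ovalH κ (P i)).comp
              (by fun_prop : Continuous fun b : ι → ℝ => (b i, x))
          · exact (continuous_ovalH κ (P j)).comp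
              (by fun_prop : Continuous fun b : ι → ℝ => (b j, x))
        exact hcl.mem_of_frequently_of_tendsto (hx.mono fun k hk => hk.2 j) hub'
  have hWcompact : IsCompact W :=
    isCompact_Icc.of_isClosed_subset hWclosed (fun b hb => hb.1)
  have hWne : W.Nonempty := by
    refine ⟨c, ⟨le_rfl, hcB⟩, ⟨Classical.arbitrary ι, rfl⟩, fun i hi => absurd hi (lt_irrefl _)⟩
  obtain ⟨b, hbW, hbmax⟩ := hWcompact.exists_isMaxOn hWne
    (f := fun b : ι → ℝ => ∑ i, b i) (by fun_prop)
  obtain ⟨hbI, hbZ, hbw⟩ := hbW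
  have hargex : ∀ y ∈ closure Ω, ∃ i, IsArgmax κ Ω (R b) (P i) y := by
    intro y hy
    obtain ⟨i, hi⟩ := hVcov b y hy
    exact ⟨i, hVarg b hbI i y hi⟩
  have hRbb := hRb b hbI hbZ
  -- key claim
  have claim : ∀ i, (∃ j, j ≠ i ∧ b j = c j) → l (cellV κ Ω P i b) ≤ w i := by
    rintro i ⟨j, hji, hj⟩
    by_cases hbB : b i = B i
    · have hem : cellV κ Ω P i b = ∅ := by
        rw [Set.eq_empty_iff_forall_notMem]
        intro x hx
        have h1 := hx.2 j
        have h2 := hhup b hbI j hj x hx.1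
        have h3 : r₀ ≤ ovalH κ (b i) (P i) x := by
          rw [le_ovalH_iff hκ0 hκ1 (hΩn x hx.1) (hrange b hbI i).1 (hrange b hbI i).2, hbB]
          exact ovCost_upper hκ0 (hΩn x hx.1) hr0.le
        linarith
      rw [hem, measure_empty]; exact zero_le
    have hlt : b i < B i := lt_of_le_of_ne (hbI.2 i) hbB
    set ε : ℕ → ℝ := fun k => (B i - b i) / ((k : ℝ) + 1) with hε
    have hε0 : ∀ k, 0 < ε k := fun k => div_pos (by linarith) (by positivity)
    have hε1 : ∀ k, ε k ≤ B i - b i := fun k =>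
      div_le_self (by linarith) (by have : (0 : ℝ) ≤ k := Nat.cast_nonneg k
                                    linarith)
    have hεt : Filter.Tendsto ε Filter.atTop (nhds 0) := by
      have := (tendsto_one_div_add_atTop_nhds_zero_nat (𝕜 := ℝ)).const_mul (B i - b i)
      simpa [hε, div_eq_mul_inv] using this
    set b' : ℕ → ι → ℝ := fun k => Function.update b i (b i + ε k) with hb'
    have hb'i : ∀ k, b' k i = b i + ε k := fun k => by simp [hb']
    have hb'j : ∀ k j, j ≠ i → b' k j = b j := fun k j hj => by simp [hb', hj]
    have hbb' : ∀ k, b ≤ b' k := by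
      intro k j
      by_cases h : j = i
      · subst h; rw [hb'i]; linarith [hε0 k]
      · rw [hb'j k j h]
    have hb'I : ∀ k, b' k ∈ Set.Icc c B := by
      intro k
      refine ⟨hbI.1.trans (hbb' k), fun j => ?_⟩
      by_cases h : j = i
      · subst h; rw [hb'i]; linarith [hε1 k]
      · rw [hb'j k j h]; exact hbI.2 j
    have hnotW : ∀ k, b' k ∉ W := by
      intro k hk
      have h1 : ∑ i, b' k i ≤ ∑ i, b i := hbmax hk
      have h2 : ∑ i, b i < ∑ i, b' k i :=
        Finset.sum_lt_sum (fun j _ => hbb' k j) ⟨i, Finset.mem_univ i, by rw [hb'i]; linarith [hε0 k]⟩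
      linarith
    have hsmall : ∀ k, l (cellV κ Ω P i (b' k)) ≤ w i := by
      intro k
      by_contra hcon
      push Not at hcon
      apply hnotW k
      refine ⟨hb'I k, ⟨j, by rw [hb'j k j hji, hj]⟩, fun q hq => ?_⟩
      by_cases h : q = i
      · subst h; exact hcon.le
      · rw [hb'j k q h] at hq
        refine (hbw q hq).trans (measure_mono ?_)
        intro x hx
        refine ⟨hx.1, fun p => ?_⟩
        rw [hb'j k q h]
        refine (hx.2 p).trans ?_
        exact ovalH_mono hκ0 hκ1 (hΩn x hx.1) (hrange b hbI p).1 (hrange _ (hb'I k) p).2 (hbb' k p)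
    set Z := {y | y ∈ closure Ω ∧ ∃ P₁ ∈ D, ∃ P₂ ∈ D, P₁ ≠ P₂ ∧
        IsArgmax κ Ω (R b) P₁ y ∧ IsArgmax κ Ω (R b) P₂ y} with hZ
    have hZ0 : l Z = 0 := hnull (R b) hRbb (fun y hy => (hargex y hy).imp' P (fun _ h => h))
    rw [← measure_sdiff_null (s := cellV κ Ω P i b) hZ0]
    refine measure_le_of_eventually (A := fun k => cellV κ Ω P i (b' k)) ?_ hsmall
    rintro x ⟨hxV, hxZ⟩
    have hstrict : ∀ p, p ≠ i → ovalH κ (b i) (P i) x < ovalH κ (b p) (P p) x := by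
      intro p hp
      refine lt_of_le_of_ne (hxV.2 p) fun heq => hxZ ?_
      have hxp : x ∈ cellV κ Ω P p b := ⟨hxV.1, fun q => heq ▸ hxV.2 q⟩
      exact ⟨hxV.1, P i, hPD i, P p, hPD p, fun h => hp (hPinj h).symm,
        hVarg b hbI i x hxV, hVarg b hbI p x hxp⟩
    have hconv : Filter.Tendsto (fun k => ovalH κ (b' k i) (P i) x) Filter.atTop
        (nhds (ovalH κ (b i) (P i) x)) := by
      have hcont : Continuous fun β : ℝ => ovalH κ β (P i) x :=
        (continuous_ovalH κ (P i)).comp (by fun_prop : Continuous fun β : ℝ => (β, x))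
      have h1 : Filter.Tendsto (fun k => b' k i) Filter.atTop (nhds (b i)) := by
        simp only [hb'i]
        simpa using hεt.const_add (b i)
      exact (hcont.tendsto (b i)).comp h1
    have hall : ∀ᶠ k in Filter.atTop, ∀ p, p ≠ i →
        ovalH κ (b' k i) (P i) x < ovalH κ (b p) (P p) x := by
      rw [Filter.eventually_all]
      intro p
      by_cases hp : p = i
      · exact Filter.Eventually.of_forall fun k h => absurd hp h
      · filter_upwards [hconv.eventually (gt_mem_nhds (hstrict p hp))] with k hk _
        exact hk
    filter_upwards [hall] with k hk
    refine ⟨hxV.1, fun p => ?_⟩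
    by_cases hp : p = i
    · subst hp; exact le_rfl
    · rw [hb'j k p hp]; exact (hk p hp).le
  have hfinal : ∀ i, w i ≤ l (cellV κ Ω P i b) := by
    intro i
    by_cases hi : c i < b i
    · exact hbw i hi
    have hi' : b i = c i := le_antisymm (not_lt.1 hi) (hbI.1 i)
    have h1 : ∑ j, w j ≤ ∑ j, l (cellV κ Ω P j b) := by
      rw [hw]
      refine (measure_mono ?_).trans (measure_iUnion_fintype_le l _)
      intro x hx
      exact Set.mem_iUnion.2 (hVcov b x hx)
    rw [← Finset.add_sum_erase _ _ (Finset.mem_univ i),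
      ← Finset.add_sum_erase _ _ (Finset.mem_univ i)] at h1
    have h2 : ∑ j ∈ Finset.univ.erase i, l (cellV κ Ω P j b) ≤ ∑ j ∈ Finset.univ.erase i, w j :=
      Finset.sum_le_sum fun j hj => claim j ⟨i, (Finset.ne_of_mem_erase hj).symm, hi'⟩
    have h3 : ∑ j ∈ Finset.univ.erase i, w j ≠ ⊤ := by
      refine ne_top_of_le_ne_top (measure_ne_top l (closure Ω)) ?_
      rw [← hw]
      exact Finset.sum_le_sum_of_subset (Finset.erase_subset _ _)
    exact ENNReal.le_of_add_le_add_right h3 (h1.trans (by gcongr))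
  refine ⟨R b, hRbb, ?_, hargex, fun i => (hfinal i).trans (measure_mono ?_)⟩
  · have hx1 := hΩn x₀ hx₀
    apply le_antisymm
    · obtain ⟨j, hj⟩ := hbZ
      by_contra hcon
      push Not at hcon
      have h1 := (le_ovalH_iff hκ0 hκ1 hx1 (hrange b hbI j).1 (hrange b hbI j).2 _).1 (hRle b x₀ j)
      have h2 := ovCost_ge_of (P := P j) hκ0 hx1 hcon.le
      rw [hj] at h1
      simp only [hc] at h1
      nlinarith
    · obtain ⟨i, hi⟩ := hRex b x₀
      rw [hi, le_ovalH_iff hκ0 hκ1 hx1 (hrange b hbI i).1 (hrange b hbI i).2]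
      exact hbI.1 i
  · intro x hx
    exact ⟨hx.1, hVarg b hbI i x hx⟩

lemma argmax_limit {n : ℕ} {κ : ℝ} {Ω K : Set (EuclideanSpace ℝ (Fin n))} (hK : IsCompact K)
    {ρs : ℕ → EuclideanSpace ℝ (Fin n) → ℝ} {ρ : EuclideanSpace ℝ (Fin n) → ℝ}
    (hρ : ∀ x ∈ closure Ω, Filter.Tendsto (fun k => ρs k x) Filter.atTop (nhds (ρ x)))
    {ys : ℕ → EuclideanSpace ℝ (Fin n)} {y : EuclideanSpace ℝ (Fin n)}
    (hy : Filter.Tendsto ys Filter.atTop (nhds y))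
    (hρy : Filter.Tendsto (fun k => ρs k (ys k)) Filter.atTop (nhds (ρ y)))
    {ε : ℕ → ℝ} (hε : Filter.Tendsto ε Filter.atTop (nhds 0))
    (hfr : ∃ᶠ k in Filter.atTop, ∃ Q ∈ K, ∃ P, dist P Q ≤ ε k ∧ IsArgmax κ Ω (ρs k) P (ys k)) :
    ∃ P ∈ K, IsArgmax κ Ω ρ P y := by
  obtain ⟨ψ, hψ, h⟩ := Filter.extraction_of_frequently_atTop hfr
  choose Q hQ P hPQ hP using h
  obtain ⟨Q₀, hQ₀, χ, hχ, hlim⟩ := hK.tendsto_subseq hQ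
  refine ⟨Q₀, hQ₀, fun x hx => ?_⟩
  have ht : Filter.Tendsto (fun k => ψ (χ k)) Filter.atTop Filter.atTop :=
    hψ.tendsto_atTop.comp hχ.tendsto_atTop
  have hPl : Filter.Tendsto (fun k => P (χ k)) Filter.atTop (nhds Q₀) := by
    refine (tendsto_iff_of_dist ?_).2 hlim
    refine squeeze_zero (fun _ => dist_nonneg) (fun k => hPQ (χ k)) (hε.comp ht)
  have h1 := hρ x hx |>.comp ht
  have h2 := hρy.comp ht
  have h3 := hy.comp ht
  refine le_of_tendsto_of_tendsto' (b := Filter.atTop) (f := fun k => ovCost κ (P (χ k)) x (ρs (ψ (χ k)) x))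
    (g := fun k => ovCost κ (P (χ k)) (ys (ψ (χ k))) (ρs (ψ (χ k)) (ys (ψ (χ k)))))
    ?_ ?_ (fun k => hP (χ k) x hx)
  · exact h1.add (((h1.smul_const x).sub hPl).norm.const_mul κ)
  · exact h2.add (((h2.smul h3).sub hPl).norm.const_mul κ)

lemma isClosed_preimage {n : ℕ} {κ : ℝ} {Ω K : Set (EuclideanSpace ℝ (Fin n))} (hK : IsCompact K)
    {ρ : EuclideanSpace ℝ (Fin n) → ℝ} (hρ : ContinuousOn ρ (closure Ω)) :
    IsClosed {y | y ∈ closure Ω ∧ ∃ P ∈ K, IsArgmax κ Ω ρ P y} := by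
  apply IsSeqClosed.isClosed
  intro ys y hys hy
  have hyΩ : y ∈ closure Ω := isClosed_closure.mem_of_tendsto hy
    (Filter.Eventually.of_forall fun k => (hys k).1)
  refine ⟨hyΩ, ?_⟩
  refine argmax_limit (ρs := fun _ => ρ) hK (fun x _ => tendsto_const_nhds) hy ?_
    (ε := fun _ => 0) tendsto_const_nhds ?_
  · exact (hρ y hyΩ).tendsto.comp (tendsto_nhdsWithin_iff.2
      ⟨hy, Filter.Eventually.of_forall fun k => (hys k).1⟩)
  · refine Filter.Frequently.of_forall fun k => ?_
    obtain ⟨P, hP, h⟩ := (hys k).2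
    exact ⟨P, hP, P, by simp, h⟩

lemma exists_discretization {E : Type*} [PseudoMetricSpace E] [MeasurableSpace E]
    [OpensMeasurableSpace E] {D : Set E} (hD : IsCompact D) (hne : D.Nonempty) {ε : ℝ} (hε : 0 < ε) :
    ∃ (t : Finset E) (g : E → E), (∀ p ∈ t, p ∈ D) ∧ t.Nonempty ∧ Measurable g ∧
      (∀ x, g x ∈ t) ∧ ∀ x ∈ D, dist (g x) x ≤ ε := by
  classical
  have main : ∀ t : Finset E, t.Nonempty → ∃ g : E → E, Measurable g ∧ (∀ x, g x ∈ t) ∧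
      ∀ x, (∃ p ∈ t, x ∈ Metric.ball p ε) → dist (g x) x ≤ ε := by
    intro t ht
    induction ht using Finset.Nonempty.cons_induction with
    | singleton a =>
      refine ⟨fun _ => a, measurable_const, by simp, ?_⟩
      rintro x ⟨p, hp, hx⟩
      rw [Finset.mem_singleton] at hp
      subst hp
      rw [dist_comm]; exact (Metric.mem_ball.1 hx).le
    | cons a t hat _ ih =>
      obtain ⟨g, hg, hgt, hgd⟩ := ih
      refine ⟨(Metric.ball a ε).piecewise (fun _ => a) g,
        measurable_const.piecewise Metric.isOpen_ball.measurableSet hg, ?_, ?_⟩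
      · intro x
        by_cases hx : x ∈ Metric.ball a ε
        · rw [Set.piecewise_eq_of_mem _ _ _ hx]; simp
        · rw [Set.piecewise_eq_of_notMem _ _ _ hx]; simp [hgt x]
      · rintro x ⟨p, hp, hxp⟩
        by_cases hx : x ∈ Metric.ball a ε
        · rw [Set.piecewise_eq_of_mem _ _ _ hx, dist_comm]; exact (Metric.mem_ball.1 hx).le
        · rw [Set.piecewise_eq_of_notMem _ _ _ hx]
          apply hgd
          rcases Finset.mem_cons.1 hp with rfl | h
          · exact absurd hxp hx
          · exact ⟨p, h, hxp⟩
  obtain ⟨t, htD, htf, hcov⟩ := hD.finite_cover_balls hε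
  have htne : t.Nonempty := by
    obtain ⟨x, hx⟩ := hne
    obtain ⟨p, hp, -⟩ := Set.mem_iUnion₂.1 (hcov hx)
    exact ⟨p, hp⟩
  obtain ⟨g, hg, hgt, hgd⟩ := main htf.toFinset (by simpa using htne)
  refine ⟨htf.toFinset, g, fun p hp => htD (by simpa using hp), by simpa using htne, hg, hgt, ?_⟩
  intro x hx
  apply hgd
  obtain ⟨p, hp, hxp⟩ := Set.mem_iUnion₂.1 (hcov hx)
  exact ⟨p, by simpa using hp, hxp⟩

lemma exists_subseq_limit {n : ℕ} {r₀ : ℝ} {Ω : Set (EuclideanSpace ℝ (Fin n))}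
    (hΩc : IsCompact (closure Ω)) {L : NNReal}
    {ρs : ℕ → EuclideanSpace ℝ (Fin n) → ℝ} (hlip : ∀ k, LipschitzOnWith L (ρs k) (closure Ω))
    (hb : ∀ k, ∀ x ∈ closure Ω, 0 < ρs k x ∧ ρs k x ≤ r₀) :
    ∃ (ρ : EuclideanSpace ℝ (Fin n) → ℝ) (φ : ℕ → ℕ), StrictMono φ ∧
      ∀ x ∈ closure Ω, Filter.Tendsto (fun k => ρs (φ k) x) Filter.atTop (nhds (ρ x)) := by
  classical
  have : CompactSpace (closure Ω) := isCompact_iff_compactSpace.1 hΩc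
  have hl : ∀ k, LipschitzWith L ((closure Ω).domRestrict (ρs k)) := fun k =>
    lipschitzOnWith_iff_restrict.1 (hlip k)
  set F : ℕ → BoundedContinuousFunction (closure Ω) ℝ := fun k =>
    BoundedContinuousFunction.mkOfCompact ⟨(closure Ω).domRestrict (ρs k), (hl k).continuous⟩ with hF
  have hcomp := BoundedContinuousFunction.arzela_ascoli (Set.Icc 0 r₀) isCompact_Icc (Set.range F)
    (by
      rintro f x ⟨k, rfl⟩
      exact ⟨(hb k x x.2).1.le, (hb k x x.2).2⟩)
    (by
      apply UniformEquicontinuous.equicontinuous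
      apply LipschitzWith.uniformEquicontinuous _ L
      rintro ⟨f, k, rfl⟩
      exact hl k)
  obtain ⟨f, -, φ, hφ, hlim⟩ := hcomp.tendsto_subseq (x := F)
    (fun k => subset_closure ⟨k, rfl⟩)
  refine ⟨fun x => if h : x ∈ closure Ω then f ⟨x, h⟩ else 0, φ, hφ, fun x hx => ?_⟩
  have h1 : Filter.Tendsto (fun k => F (φ k) ⟨x, hx⟩) Filter.atTop (nhds (f ⟨x, hx⟩)) :=
    ((BoundedContinuousFunction.lipschitz_eval_const (⟨x, hx⟩ : closure Ω)).continuous.tendsto f).comp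
      hlim
  simp only [dif_pos hx]
  exact h1

lemma level_refractor {n : ℕ} {κ τ r₀ : ℝ} (hκ0 : 0 < κ) (hκ1 : κ < 1)
    (hττ : τ < 1 - κ)
    {Ω D : Set (EuclideanSpace ℝ (Fin n))} (hΩn : ∀ x ∈ closure Ω, ‖x‖ = 1)
    (hD : IsCompact D) (hDne : D.Nonempty)
    (hD0 : (0 : EuclideanSpace ℝ (Fin n)) ∉ D)
    (hr : ∀ P ∈ D, (1 + κ) * r₀ ≤ τ * ‖P‖)
    (l : Measure (EuclideanSpace ℝ (Fin n))) [IsFiniteMeasure l]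
    (hnull : ∀ (ρ : EuclideanSpace ℝ (Fin n) → ℝ),
      (∀ x ∈ closure Ω, 0 < ρ x ∧ ρ x ≤ r₀) → (∀ y ∈ closure Ω, ∃ P, IsArgmax κ Ω ρ P y) →
      l {y | y ∈ closure Ω ∧ ∃ P₁ ∈ D, ∃ P₂ ∈ D, P₁ ≠ P₂ ∧
        IsArgmax κ Ω ρ P₁ y ∧ IsArgmax κ Ω ρ P₂ y} = 0)
    {x₀ : EuclideanSpace ℝ (Fin n)} (hx₀ : x₀ ∈ closure Ω) {s : ℝ} (hs0 : 0 < s)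
    (hsr : (1 + κ) * s < (1 - κ) * r₀)
    (μ : Measure (EuclideanSpace ℝ (Fin n))) (hmass : l (closure Ω) = μ Set.univ)
    {ε : ℝ} (hε : 0 < ε) :
    ∃ ρ : EuclideanSpace ℝ (Fin n) → ℝ, (∀ x ∈ closure Ω, 0 < ρ x ∧ ρ x ≤ r₀) ∧ ρ x₀ = s ∧
      (∀ y ∈ closure Ω, ∃ P ∈ D, IsArgmax κ Ω ρ P y) ∧
      ∀ K ⊆ D, ∃ S : Set (EuclideanSpace ℝ (Fin n)), S.Finite ∧
        (∀ p ∈ S, ∃ q ∈ K, dist p q ≤ ε) ∧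
        μ K ≤ l {y | y ∈ closure Ω ∧ ∃ P ∈ S, IsArgmax κ Ω ρ P y} := by
  classical
  obtain ⟨t, g, htD, htne, hg, hgt, hgd⟩ := exists_discretization hD hDne hε
  have : Nonempty t := htne.to_subtype
  have hsum : ∑ i : t, μ (g ⁻¹' {(i : EuclideanSpace ℝ (Fin n))}) = l (closure Ω) := by
    rw [hmass, Finset.sum_coe_sort t (fun i => μ (g ⁻¹' {i})),
      sum_measure_preimage_singleton t (fun y _ => hg (measurableSet_singleton y))]
    congr 1
    ext x; simp [hgt x]
  obtain ⟨ρ, hρb, hρx, hρe, hρw⟩ := discrete_refractor hκ0 hκ1 hττ hΩn hD0 hr l hnull hx₀ hs0 hsr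
    (fun i : t => (i : EuclideanSpace ℝ (Fin n))) (fun i => htD i i.2) Subtype.val_injective
    (fun i : t => μ (g ⁻¹' {(i : EuclideanSpace ℝ (Fin n))})) hsum
  have hex : ∀ y ∈ closure Ω, ∃ P, IsArgmax κ Ω ρ P y := fun y hy =>
    let ⟨i, hi⟩ := hρe y hy; ⟨i, hi⟩
  have hcont : ContinuousOn ρ (closure Ω) :=
    (refractor_lip hκ0 hκ1 hΩn hρb hex).continuousOn
  refine ⟨ρ, hρb, hρx, fun y hy => ?_, fun K hK => ?_⟩
  · obtain ⟨i, hi⟩ := hρe y hy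
    exact ⟨i, htD i i.2, hi⟩
  set T := t.filter (fun p => ∃ q ∈ K, dist p q ≤ ε) with hT
  refine ⟨T, T.finite_toSet, fun p hp => (Finset.mem_filter.1 hp).2, ?_⟩
  have hcell : ∀ p, MeasurableSet {y | y ∈ closure Ω ∧ IsArgmax κ Ω ρ p y} := by
    intro p
    have := (isClosed_preimage (κ := κ) (isCompact_singleton (x := p)) hcont).measurableSet
    simpa using this
  have h1 : μ K ≤ ∑ p ∈ T, μ (g ⁻¹' {p}) := by
    rw [sum_measure_preimage_singleton T (fun y _ => hg (measurableSet_singleton y))]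
    apply measure_mono
    intro x hx
    exact Finset.mem_coe.2 (Finset.mem_filter.2 ⟨hgt x, x, hx, hgd x (hK hx)⟩)
  have h2 : ∑ p ∈ T, μ (g ⁻¹' {p}) ≤ ∑ p ∈ T, l {y | y ∈ closure Ω ∧ IsArgmax κ Ω ρ p y} := by
    refine Finset.sum_le_sum fun p hp => ?_
    exact hρw ⟨p, (Finset.mem_filter.1 hp).1⟩
  have h3 : l (⋃ p ∈ T, {y | y ∈ closure Ω ∧ IsArgmax κ Ω ρ p y}) =
      ∑ p ∈ T, l {y | y ∈ closure Ω ∧ IsArgmax κ Ω ρ p y} := by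
    refine measure_biUnion_finset₀ ?_ (fun p _ => (hcell p).nullMeasurableSet)
    intro p hp q hq hpq
    refine measure_mono_null ?_ (hnull ρ hρb hex)
    rintro y ⟨⟨hy, hyp⟩, ⟨-, hyq⟩⟩
    exact ⟨hy, p, htD p (Finset.mem_filter.1 hp).1, q, htD q (Finset.mem_filter.1 hq).1, hpq,
      hyp, hyq⟩
  refine (h1.trans h2).trans (h3.symm.le.trans (measure_mono ?_))
  intro y hy
  obtain ⟨p, hp, hy⟩ := Set.mem_iUnion₂.1 hy
  exact ⟨hy.1, p, hp, hy.2⟩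

lemma supports_iff {n : ℕ} {κ τ r₀ : ℝ} (hκ0 : 0 < κ) (hκ1 : κ < 1)
    (hττ : τ < 1 - κ)
    {Ω D : Set (EuclideanSpace ℝ (Fin n))} (hΩn : ∀ x ∈ closure Ω, ‖x‖ = 1)
    (hD0 : (0 : EuclideanSpace ℝ (Fin n)) ∉ D)
    (hH1 : ∀ x ∈ closure Ω, ∀ P ∈ D, (κ + τ) * ‖P‖ ≤ ⟪x, P⟫)
    (hr : ∀ P ∈ D, (1 + κ) * r₀ ≤ τ * ‖P‖)
    {ρ : EuclideanSpace ℝ (Fin n) → ℝ}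
    (hρ : ∀ x ∈ closure Ω, 0 < ρ x ∧ ρ x ≤ r₀) {P y : EuclideanSpace ℝ (Fin n)}
    (hP : P ∈ D) (hy : y ∈ closure Ω) :
    (∃ b : ℝ, SupportsAtLt κ Ω ρ P b y) ↔ IsArgmax κ Ω ρ P y := by
  constructor
  · rintro ⟨b, h1, h2, -, h4, h5⟩ x hx
    rw [h5, ovCost_ovalH hκ0 hκ1 (hΩn y hy) h1 h2, ← le_ovalH_iff hκ0 hκ1 (hΩn x hx) h1 h2]
    exact h4 x hx
  · intro h
    obtain ⟨hy0, hyr⟩ := hρ y hy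
    have hPp : 0 < ‖P‖ := norm_pos_iff.2 (fun h => hD0 (h ▸ hP))
    have hup := ovCost_upper (P := P) hκ0 (hΩn y hy) hy0.le
    have hlow := ovCost_lower (P := P) hκ0 (hΩn y hy) hy0.le
    have hrP := hr P hP
    have hle : ovCost κ P y (ρ y) ≤ (κ + τ) * ‖P‖ := by nlinarith
    have h1 : κ * ‖P‖ < ovCost κ P y (ρ y) := by nlinarith
    have h2 : ovCost κ P y (ρ y) < ‖P‖ := by nlinarith
    refine ⟨ovCost κ P y (ρ y), h1, h2, fun x hx => hle.trans (hH1 x hx P hP), fun x hx => ?_, ?_⟩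
    · rw [le_ovalH_iff hκ0 hκ1 (hΩn x hx) h1 h2]; exact h x hx
    · apply le_antisymm
      · rw [le_ovalH_iff hκ0 hκ1 (hΩn y hy) h1 h2]
      · by_contra hcon
        push Not at hcon
        have h3 := ovCost_ge_of (P := P) hκ0 (hΩn y hy) hcon.le
        rw [ovCost_ovalH hκ0 hκ1 (hΩn y hy) h1 h2] at h3
        nlinarith

lemma q_cube_bound {κ s r₀ : ℝ} (hκ0 : 0 < κ) (hκ1 : κ < 1) (hr0 : 0 < r₀)
    (h : s < ((1 - κ) / (1 + κ)) ^ 3 * r₀) : (1 + κ) * s < (1 - κ) * r₀ := by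
  have hk : 0 < 1 + κ := by linarith
  have hq0 : 0 ≤ (1 - κ) / (1 + κ) := div_nonneg (by linarith) hk.le
  have hq1 : (1 - κ) / (1 + κ) ≤ 1 := by rw [div_le_one hk]; linarith
  have h3 : ((1 - κ) / (1 + κ)) ^ 3 ≤ (1 - κ) / (1 + κ) := by
    simpa using pow_le_pow_of_le_one hq0 hq1 (show 1 ≤ 3 by norm_num)
  have h4 : s < (1 - κ) / (1 + κ) * r₀ := h.trans_le (by gcongr)
  have h5 := mul_lt_mul_of_pos_left h4 hk
  have h6 : (1 + κ) * ((1 - κ) / (1 + κ) * r₀) = (1 - κ) * r₀ := by field_simp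
  rwa [h6] at h5

lemma limit_refractor {n : ℕ} {κ τ r₀ : ℝ} (hκ0 : 0 < κ) (hκ1 : κ < 1)
    (hττ : τ < 1 - κ)
    {Ω D : Set (EuclideanSpace ℝ (Fin n))} (hΩn : ∀ x ∈ closure Ω, ‖x‖ = 1)
    (hΩc : IsCompact (closure Ω))
    (hD : IsCompact D) (hDne : D.Nonempty)
    (hD0 : (0 : EuclideanSpace ℝ (Fin n)) ∉ D)
    (hr : ∀ P ∈ D, (1 + κ) * r₀ ≤ τ * ‖P‖)
    (l : Measure (EuclideanSpace ℝ (Fin n))) [IsFiniteMeasure l]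
    (hnull : ∀ (ρ : EuclideanSpace ℝ (Fin n) → ℝ),
      (∀ x ∈ closure Ω, 0 < ρ x ∧ ρ x ≤ r₀) → (∀ y ∈ closure Ω, ∃ P, IsArgmax κ Ω ρ P y) →
      l {y | y ∈ closure Ω ∧ ∃ P₁ ∈ D, ∃ P₂ ∈ D, P₁ ≠ P₂ ∧
        IsArgmax κ Ω ρ P₁ y ∧ IsArgmax κ Ω ρ P₂ y} = 0)
    {x₀ : EuclideanSpace ℝ (Fin n)} (hx₀ : x₀ ∈ closure Ω) {s : ℝ} (hs0 : 0 < s)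
    (hsr : (1 + κ) * s < (1 - κ) * r₀)
    (μ : Measure (EuclideanSpace ℝ (Fin n))) (hmass : l (closure Ω) = μ Set.univ) :
    ∃ ρ : EuclideanSpace ℝ (Fin n) → ℝ, (∀ x ∈ closure Ω, 0 < ρ x ∧ ρ x ≤ r₀) ∧ ρ x₀ = s ∧
      (∀ y ∈ closure Ω, ∃ P ∈ D, IsArgmax κ Ω ρ P y) ∧
      ∀ K ⊆ D, IsCompact K → μ K ≤ l {y | y ∈ closure Ω ∧ ∃ P ∈ K, IsArgmax κ Ω ρ P y} := by
  have hεpos : ∀ k : ℕ, (0 : ℝ) < 1 / ((k : ℝ) + 1) := fun k => Nat.one_div_pos_of_nat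
  have hstep := fun k : ℕ => level_refractor hκ0 hκ1 hττ hΩn hD hDne hD0 hr l hnull hx₀ hs0 hsr μ
    hmass (hεpos k)
  choose ρs hb hx hex hK using hstep
  have hex' : ∀ k, ∀ y ∈ closure Ω, ∃ P, IsArgmax κ Ω (ρs k) P y := fun k y hy =>
    let ⟨P, _, h⟩ := hex k y hy; ⟨P, h⟩
  have hlip := fun k => refractor_lip hκ0 hκ1 hΩn (hb k) (hex' k)
  obtain ⟨ρ, φ, hφ, hlim⟩ := exists_subseq_limit hΩc hlip hb
  have hε0 : Filter.Tendsto (fun k : ℕ => (1 : ℝ) / ((φ k : ℝ) + 1)) Filter.atTop (nhds 0) :=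
    tendsto_one_div_add_atTop_nhds_zero_nat.comp hφ.tendsto_atTop
  have hlow : ∀ k, ∀ x ∈ closure Ω, (1 - κ) * s / (1 + κ) ≤ ρs k x := by
    intro k x hxΩ
    obtain ⟨P, hP⟩ := hex' k x hxΩ
    have h1 := hP x₀ hx₀
    rw [hx k] at h1
    have h2 := ovCost_lower (P := P) hκ0 (hΩn x₀ hx₀) hs0.le
    have h3 := ovCost_upper (P := P) hκ0 (hΩn x hxΩ) (hb k x hxΩ).1.le
    rw [div_le_iff₀ (by linarith)]
    linarith
  have hpos : 0 < (1 - κ) * s / (1 + κ) :=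
    div_pos (mul_pos (by linarith) hs0) (by linarith)
  refine ⟨ρ, fun x hxΩ => ⟨?_, ?_⟩, ?_, ?_, ?_⟩
  · exact hpos.trans_le (ge_of_tendsto' (hlim x hxΩ) fun k => hlow _ x hxΩ)
  · exact le_of_tendsto' (hlim x hxΩ) fun k => (hb _ x hxΩ).2
  · refine tendsto_nhds_unique (hlim x₀ hx₀) ?_
    simp only [hx]
    exact tendsto_const_nhds
  · intro y hy
    refine argmax_limit (ρs := fun k => ρs (φ k)) (ys := fun _ => y) hD hlim tendsto_const_nhds
      (hlim y hy) hε0 (Filter.Frequently.of_forall fun k => ?_)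
    obtain ⟨P, hP, h⟩ := hex (φ k) y hy
    exact ⟨P, hP, P, by rw [dist_self]; exact (hεpos _).le, h⟩
  · intro K hKD hKc
    choose S hSf hSd hSm using fun k => hK (φ k) K hKD
    refine le_measure_of_frequently (fun k => ?_) ?_ hSm
    · exact (isClosed_preimage (hSf k).isCompact (hlip (φ k)).continuousOn).measurableSet
    · intro y hy
      obtain ⟨k₀, hk₀⟩ := hy.exists
      refine ⟨hk₀.1, ?_⟩
      refine argmax_limit (ρs := fun k => ρs (φ k)) (ys := fun _ => y) hKc hlim tendsto_const_nhds
        (hlim y hk₀.1) hε0 (hy.mono fun k hk => ?_)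
      obtain ⟨-, P, hP, h⟩ := hk
      obtain ⟨Q, hQ, hd⟩ := hSd k P hP
      exact ⟨Q, hQ, P, hd, h⟩


/-- Theorem 5.7: existence of a near field refractor (case `κ < 1`) for a general Radon
measure `μ` on `D`, passing through a prescribed point `X₀`. -/
theorem stmt16 {n : ℕ} (hn : 2 ≤ n) (κ τ r₀ : ℝ) (hκ0 : 0 < κ) (hκ1 : κ < 1)
    (hτ0 : 0 < τ) (hττ : τ < 1 - κ) (hr0 : 0 < r₀)
    (Ω D : Set (EuclideanSpace ℝ (Fin n)))
    -- Ω is a domain in the unit sphere with |∂Ω| = 0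
    (hΩsph : Ω ⊆ Metric.sphere 0 1)
    (hΩopen : ∃ U : Set (EuclideanSpace ℝ (Fin n)), IsOpen U ∧ Ω = U ∩ Metric.sphere 0 1)
    (hbdry : sphereMeasure n (closure Ω \ Ω) = 0)
    -- D is compact and 0 ∉ D
    (hD : IsCompact D) (hD0 : (0 : EuclideanSpace ℝ (Fin n)) ∉ D)
    -- (H1)
    (hH1 : ∀ x ∈ closure Ω, ∀ P ∈ D, (κ + τ) * ‖P‖ ≤ ⟪x, P⟫)
    -- (H2)
    (hH2r : r₀ ≤ τ / (1 + κ) * Metric.infDist 0 D)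
    (hH2 : ∀ X ∈ coneQ Ω r₀, ∀ m : EuclideanSpace ℝ (Fin n), ‖m‖ = 1 →
      (D ∩ {Z | ∃ t : ℝ, 0 ≤ t ∧ Z = X + t • m}).Subsingleton)
    -- a Radon measure μ on D and the energy density f with conservation of energy
    (μ : Measure (EuclideanSpace ℝ (Fin n))) [IsFiniteMeasure μ] (hμD : μ Dᶜ = 0)
    (f : EuclideanSpace ℝ (Fin n) → ℝ) (hfmeas : Measurable f)
    (hfpos : ∀ᵐ x ∂((sphereMeasure n).restrict Ω), 0 < f x)
    (hmass : ∫⁻ x in Ω, ENNReal.ofReal (f x) ∂(sphereMeasure n) = μ D)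
    -- the point X₀
    (X₀ : EuclideanSpace ℝ (Fin n)) (hX₀Q : X₀ ∈ coneQ Ω r₀)
    (hX₀pos : 0 < ‖X₀‖) (hX₀small : ‖X₀‖ < ((1 - κ) / (1 + κ)) ^ 3 * r₀) :
    ∃ ρ : EuclideanSpace ℝ (Fin n) → ℝ, IsNearFieldRefractorLt κ r₀ Ω D ρ ∧
      ρ (‖X₀‖⁻¹ • X₀) = ‖X₀‖ ∧
      ∀ F : Set (EuclideanSpace ℝ (Fin n)), MeasurableSet F → F ⊆ D →
        ∫⁻ x in refractorPreimageLt κ Ω D ρ F, ENNReal.ofReal (f x) ∂(sphereMeasure n) =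
          μ F := by
  have hDne : D.Nonempty := by
    by_contra h
    rw [Set.not_nonempty_iff_eq_empty.1 h, Metric.infDist_empty] at hH2r
    linarith
  have hk : 0 < 1 + κ := by linarith
  have hΩcl : closure Ω ⊆ Metric.sphere 0 1 := closure_minimal hΩsph Metric.isClosed_sphere
  have hΩn : ∀ x ∈ closure Ω, ‖x‖ = 1 := fun x hx => by simpa using hΩcl hx
  have hΩc : IsCompact (closure Ω) := (isCompact_sphere 0 1).of_isClosed_subset isClosed_closure hΩcl
  have hr : ∀ P ∈ D, (1 + κ) * r₀ ≤ τ * ‖P‖ := by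
    intro P hP
    have h1 : Metric.infDist 0 D ≤ ‖P‖ := by
      simpa using Metric.infDist_le_dist_of_mem (x := (0 : EuclideanSpace ℝ (Fin n))) hP
    have h2 : r₀ ≤ τ / (1 + κ) * ‖P‖ :=
      hH2r.trans (mul_le_mul_of_nonneg_left h1 (div_nonneg hτ0.le hk.le))
    have h3 := mul_le_mul_of_nonneg_left h2 hk.le
    have h4 : (1 + κ) * (τ / (1 + κ) * ‖P‖) = τ * ‖P‖ := by field_simp
    rwa [h4] at h3
  have hsr := q_cube_bound hκ0 hκ1 hr0 hX₀small
  have hx₀ : ‖X₀‖⁻¹ • X₀ ∈ closure Ω := by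
    obtain ⟨x, hx, t, ht, -, rfl⟩ := hX₀Q
    rw [norm_smul, hΩn x hx, mul_one, Real.norm_of_nonneg ht.le, smul_smul,
      inv_mul_cancel₀ ht.ne', one_smul]
    exact hx
  -- the double points are negligible
  have hσnull : ∀ (ρ : EuclideanSpace ℝ (Fin n) → ℝ),
      (∀ x ∈ closure Ω, 0 < ρ x ∧ ρ x ≤ r₀) → (∀ y ∈ closure Ω, ∃ P, IsArgmax κ Ω ρ P y) →
      sphereMeasure n {y | y ∈ closure Ω ∧ ∃ P₁ ∈ D, ∃ P₂ ∈ D, P₁ ≠ P₂ ∧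
        IsArgmax κ Ω ρ P₁ y ∧ IsArgmax κ Ω ρ P₂ y} = 0 := by
    intro ρ hρ hs
    have h1 := null_set hn hκ0 hκ1 hττ hτ0 hΩsph hΩopen hD0 hH1 hr hH2
      (refractor_lip hκ0 hκ1 hΩn hρ hs) hρ
    refine measure_mono_null ?_ (measure_union_null h1 hbdry)
    rintro y ⟨hy, h⟩
    by_cases hyΩ : y ∈ Ω
    · exact Or.inl ⟨hyΩ, h⟩
    · exact Or.inr ⟨hy, hyΩ⟩
  set g : EuclideanSpace ℝ (Fin n) → ENNReal := fun x => ENNReal.ofReal (f x) with hg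
  set l : Measure (EuclideanSpace ℝ (Fin n)) :=
    ((sphereMeasure n).restrict (closure Ω)).withDensity g with hl
  have hlA : ∀ A ⊆ closure Ω, MeasurableSet A → l A = ∫⁻ x in A, g x ∂(sphereMeasure n) := by
    intro A hA hAm
    rw [hl, withDensity_apply _ hAm, Measure.restrict_restrict hAm, Set.inter_eq_left.2 hA]
  have hae : (closure Ω : Set (EuclideanSpace ℝ (Fin n))) =ᵐ[sphereMeasure n] Ω := by
    rw [ae_eq_set]
    exact ⟨hbdry, by rw [Set.diff_eq_empty.2 subset_closure, measure_empty]⟩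
  have hlΩ : l (closure Ω) = μ D := by
    rw [hlA _ subset_rfl isClosed_closure.measurableSet, setLIntegral_congr hae, hmass]
  have hμu : μ Set.univ = μ D := by
    apply le_antisymm _ (measure_mono (Set.subset_univ _))
    calc μ Set.univ = μ (D ∪ Dᶜ) := by rw [Set.union_compl_self]
      _ ≤ μ D + μ Dᶜ := measure_union_le _ _
      _ = μ D := by rw [hμD, add_zero]
  have hlu : l Set.univ = l (closure Ω) := by
    rw [hlA _ subset_rfl isClosed_closure.measurableSet, hl, withDensity_apply _ MeasurableSet.univ,
      Measure.restrict_univ]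
  have : IsFiniteMeasure l := ⟨by rw [hlu, hlΩ]; exact measure_lt_top μ D⟩
  have hnull : ∀ (ρ : EuclideanSpace ℝ (Fin n) → ℝ),
      (∀ x ∈ closure Ω, 0 < ρ x ∧ ρ x ≤ r₀) → (∀ y ∈ closure Ω, ∃ P, IsArgmax κ Ω ρ P y) →
      l {y | y ∈ closure Ω ∧ ∃ P₁ ∈ D, ∃ P₂ ∈ D, P₁ ≠ P₂ ∧
        IsArgmax κ Ω ρ P₁ y ∧ IsArgmax κ Ω ρ P₂ y} = 0 := by
    intro ρ hρ hs
    exact ((withDensity_absolutelyContinuous _ g).trans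
      Measure.restrict_le_self.absolutelyContinuous) (hσnull ρ hρ hs)
  obtain ⟨ρ, hρb, hρx, hρe, hρK⟩ := limit_refractor hκ0 hκ1 hττ hΩn hΩc hD hDne hD0 hr l hnull hx₀
    hX₀pos hsr μ (hlΩ.trans hμu.symm)
  have hρe' : ∀ y ∈ closure Ω, ∃ P, IsArgmax κ Ω ρ P y := fun y hy =>
    let ⟨P, _, h⟩ := hρe y hy; ⟨P, h⟩
  have hcont := (refractor_lip hκ0 hκ1 hΩn hρb hρe').continuousOn
  have hpre : ∀ F ⊆ D, refractorPreimageLt κ Ω D ρ F =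
      {y | y ∈ closure Ω ∧ ∃ P ∈ F, IsArgmax κ Ω ρ P y} := by
    intro F hF
    ext y
    constructor
    · rintro ⟨hy, P, ⟨hPD, hPb⟩, hPF⟩
      exact ⟨hy, P, hPF, (supports_iff hκ0 hκ1 hττ hΩn hD0 hH1 hr hρb hPD hy).1 hPb⟩
    · rintro ⟨hy, P, hPF, h⟩
      exact ⟨hy, P, ⟨hF hPF, (supports_iff hκ0 hκ1 hττ hΩn hD0 hH1 hr hρb (hF hPF) hy).2 h⟩, hPF⟩
  refine ⟨ρ, ⟨hcont, hρb, fun y hy => ?_⟩, hρx, ?_⟩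
  · obtain ⟨P, hP, h⟩ := hρe y hy
    exact ⟨P, hP, (supports_iff hκ0 hκ1 hττ hΩn hD0 hH1 hr hρb hP hy).2 h⟩
  intro F hFm hFD
  rw [hpre F hFD]
  set N : Set (EuclideanSpace ℝ (Fin n)) → Set (EuclideanSpace ℝ (Fin n)) :=
    fun G => {y | y ∈ closure Ω ∧ ∃ P ∈ G, IsArgmax κ Ω ρ P y} with hN
  have hNm : ∀ K, IsCompact K → MeasurableSet (N K) := fun K hK =>
    (isClosed_preimage hK hcont).measurableSet
  have hNΩ : ∀ G, N G ⊆ closure Ω := fun G y hy => hy.1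
  change ∫⁻ x in N F, g x ∂(sphereMeasure n) = μ F
  have hDFm : MeasurableSet (D \ F) := hD.measurableSet.diff hFm
  have hsplit : μ F + μ (D \ F) = μ D := by
    have := measure_inter_add_diff (μ := μ) D hFm
    rwa [Set.inter_eq_right.2 hFD] at this
  apply le_antisymm
  · have hstep : ∀ K ⊆ D \ F, IsCompact K → ∫⁻ x in N F, g x ∂(sphereMeasure n) + μ K ≤ μ D := by
      intro K hK hKc
      have h1 : N F ≤ᵐ[sphereMeasure n] (closure Ω \ N K : Set (EuclideanSpace ℝ (Fin n))) := by
        rw [ae_le_set]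
        refine measure_mono_null ?_ (hσnull ρ hρb hρe')
        rintro y ⟨⟨hy, P, hPF, hP⟩, hy2⟩
        have hyK : y ∈ N K := by
          by_contra hcon
          exact hy2 ⟨hy, hcon⟩
        obtain ⟨-, Q, hQK, hQ⟩ := hyK
        exact ⟨hy, P, hFD hPF, Q, (hK hQK).1, fun h => (hK hQK).2 (h ▸ hPF), hP, hQ⟩
      have h2 := lintegral_mono_set' (f := g) h1
      rw [← hlA _ Set.diff_subset (isClosed_closure.measurableSet.diff (hNm K hKc))] at h2
      have h3 := hρK K (fun x hx => (hK hx).1) hKc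
      calc _ ≤ l (closure Ω \ N K) + l (N K) := add_le_add h2 h3
        _ = l (closure Ω) := by
          rw [add_comm]
          have := measure_inter_add_diff (μ := l) (closure Ω) (hNm K hKc)
          rwa [Set.inter_eq_right.2 (hNΩ K)] at this
        _ = μ D := hlΩ
    have hsup : ∫⁻ x in N F, g x ∂(sphereMeasure n) + μ (D \ F) ≤ μ D := by
      have hfin : ∫⁻ x in N F, g x ∂(sphereMeasure n) ≤ μ D := by
        simpa using hstep ∅ (Set.empty_subset _) isCompact_empty
      refine (ENNReal.le_sub_iff_add_le_left
        (ne_top_of_le_ne_top (measure_ne_top μ D) hfin) hfin).1 ?_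
      rw [hDFm.measure_eq_iSup_isCompact_of_ne_top (measure_ne_top μ _)]
      refine iSup₂_le fun K hK => iSup_le fun hKc => ?_
      exact ENNReal.le_sub_of_add_le_left
        (ne_top_of_le_ne_top (measure_ne_top μ D) hfin) (hstep K hK hKc)
    rw [← hsplit] at hsup
    exact (ENNReal.add_le_add_iff_right (measure_ne_top μ _)).1 hsup
  · rw [hFm.measure_eq_iSup_isCompact_of_ne_top (measure_ne_top μ _)]
    refine iSup₂_le fun K hK => iSup_le fun hKc => ?_
    refine (hρK K (hK.trans hFD) hKc).trans ?_
    have hKm := hNm K hKc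
    change l (N K) ≤ _
    rw [hlA _ (hNΩ K) hKm]
    refine lintegral_mono_set ?_
    rintro y ⟨hy, P, hP, h⟩
    exact ⟨hy, P, hK hP, h⟩
end

section
/- Let Ω, Ω* ⊆ S^{n−1} with Ω a domain whose boundary has zero surface measure, 0 < κ < 1, and let m₁,…,m_N be distinct points in Ω̄* (N ≥ 2) with x·mᵢ ≥ κ for all x ∈ Ω and 1 ≤ i ≤ N. Let g₁,…,g_N > 0 and f ∈ L¹(Ω), f ≥ 0, with ∫_Ω f dσ = Σᵢ gᵢ. Then there exist positive numbers b₁,…,b_N such that ρ(x) = min_{1≤i≤N} bᵢ/(1 − κ mᵢ·x) defines a far field refractor S which is a weak solution: M_{S,f}(F) = Σ_{i : mᵢ∈F} gᵢ for every Borel F ⊆ Ω̄*; in particular M_{S,f}({mᵢ}) = gᵢ for each i. -/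
open MeasureTheory
open scoped RealInnerProductSpace

/-- The semi-ellipsoid with axis `m ∈ Ω̄*` and parameter `b > 0` supports the far field
refractor given by `ρ` at the point `ρ(y)y` (case `κ < 1`): `ρ(x) ≤ b/(1 − κ m·x)` on `Ω̄`
with equality at `y`. -/
def FFSupportsAt {n : ℕ} (κ : ℝ) (Ω Ωs : Set (EuclideanSpace ℝ (Fin n)))
    (ρ : EuclideanSpace ℝ (Fin n) → ℝ) (m : EuclideanSpace ℝ (Fin n)) (b : ℝ)
    (y : EuclideanSpace ℝ (Fin n)) : Prop :=
  m ∈ closure Ωs ∧ 0 < b ∧ (∀ x ∈ closure Ω, ρ x ≤ b / (1 - κ * ⟪m, x⟫)) ∧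
    ρ y = b / (1 - κ * ⟪m, y⟫)

/-- Far field refractor for `κ < 1`: a positive continuous radial function on `Ω̄` supported
at every point by some semi-ellipsoid with axis in `Ω̄*`. -/
def IsFarFieldRefractor {n : ℕ} (κ : ℝ) (Ω Ωs : Set (EuclideanSpace ℝ (Fin n)))
    (ρ : EuclideanSpace ℝ (Fin n) → ℝ) : Prop :=
  ContinuousOn ρ (closure Ω) ∧ (∀ x ∈ closure Ω, 0 < ρ x) ∧
    ∀ y ∈ closure Ω, ∃ (m : EuclideanSpace ℝ (Fin n)) (b : ℝ), FFSupportsAt κ Ω Ωs ρ m b y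

/-- The far field refractor map `N_S(x)`. -/
def ffMap {n : ℕ} (κ : ℝ) (Ω Ωs : Set (EuclideanSpace ℝ (Fin n)))
    (ρ : EuclideanSpace ℝ (Fin n) → ℝ) (x : EuclideanSpace ℝ (Fin n)) :
    Set (EuclideanSpace ℝ (Fin n)) :=
  {m | ∃ b : ℝ, FFSupportsAt κ Ω Ωs ρ m b x}

/-- `N_S⁻¹(F) = {x ∈ Ω̄ : N_S(x) ∩ F ≠ ∅}`. -/
def ffPreimage {n : ℕ} (κ : ℝ) (Ω Ωs : Set (EuclideanSpace ℝ (Fin n)))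
    (ρ : EuclideanSpace ℝ (Fin n) → ℝ) (F : Set (EuclideanSpace ℝ (Fin n))) :
    Set (EuclideanSpace ℝ (Fin n)) :=
  {x | x ∈ closure Ω ∧ (ffMap κ Ω Ωs ρ x ∩ F).Nonempty}

open Filter Topology in
/-- A linear functional with a local minimum on the sphere is radial there. -/
lemma ff_critical {n : ℕ} (x w : EuclideanSpace ℝ (Fin n)) (hx : ‖x‖ = 1)
    (h : ∀ᶠ y in 𝓝[Metric.sphere 0 1] x, ⟪w, y⟫ ≤ ⟪w, x⟫) :
    w = ⟪w, x⟫ • x := by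
  set v := w - ⟪w, x⟫ • x with hv
  have hxx : ⟪x, x⟫ = 1 := by rw [real_inner_self_eq_norm_sq, hx]; norm_num
  have hvx : ⟪v, x⟫ = 0 := by
    rw [hv, inner_sub_left, inner_smul_left, hxx]; simp
  have hwv : ⟪w, v⟫ = ⟪v, v⟫ := by
    have : w = v + ⟪w, x⟫ • x := by rw [hv]; abel
    conv_lhs => rw [this]
    rw [inner_add_left, inner_smul_left, real_inner_comm v x, hvx, mul_zero, add_zero]
  by_contra hne
  have hv0 : v ≠ 0 := fun h0 => hne (sub_eq_zero.mp h0)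
  have hnv : 0 < ‖v‖ := norm_pos_iff.mpr hv0
  set u := ‖v‖⁻¹ • v with hu
  have hun : ‖u‖ = 1 := by rw [hu, norm_smul]; simp [hnv.ne']
  have hux : ⟪x, u⟫ = 0 := by rw [hu, inner_smul_right, real_inner_comm, hvx, mul_zero]
  let γ : ℝ → EuclideanSpace ℝ (Fin n) := fun t => Real.cos t • x + Real.sin t • u
  have hγc : Continuous γ := by fun_prop
  have hγ0 : γ 0 = x := by simp [γ]
  have hγs : ∀ t, γ t ∈ Metric.sphere (0 : EuclideanSpace ℝ (Fin n)) 1 := by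
    intro t
    rw [mem_sphere_zero_iff_norm]
    have : ‖γ t‖ ^ 2 = 1 := by
      have h2 : ‖γ t‖ ^ 2 = ‖Real.cos t • x‖ ^ 2 + 2 * ⟪Real.cos t • x, Real.sin t • u⟫
        + ‖Real.sin t • u‖ ^ 2 := norm_add_sq_real _ _
      rw [h2, inner_smul_left, inner_smul_right, hux, norm_smul, norm_smul, hx, hun]
      simp
    have h0 := norm_nonneg (γ t)
    nlinarith
  have hγt : Tendsto γ (𝓝 0) (𝓝[Metric.sphere 0 1] x) := by
    apply tendsto_nhdsWithin_of_tendsto_nhds_of_eventually_within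
    · have := hγc.tendsto 0
      rwa [hγ0] at this
    · exact Eventually.of_forall hγs
  have hmax : IsLocalMax (fun t => ⟪w, γ t⟫) 0 := by
    have := hγt.eventually h
    filter_upwards [this] with t ht
    simpa [hγ0] using ht
  have hd : HasDerivAt (fun t => ⟪w, γ t⟫) ⟪w, u⟫ 0 := by
    have h1 : (fun t => ⟪w, γ t⟫) = fun t => Real.cos t * ⟪w, x⟫ + Real.sin t * ⟪w, u⟫ := by
      ext t
      simp [γ, inner_add_right, inner_smul_right]
    rw [h1]
    have := ((Real.hasDerivAt_cos 0).mul_const ⟪w, x⟫).add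
      ((Real.hasDerivAt_sin 0).mul_const ⟪w, u⟫)
    refine HasDerivAt.congr_deriv this ?_
    rw [Real.sin_zero, Real.cos_zero]
    ring
  have hz := hmax.hasDerivAt_eq_zero hd
  rw [hu, inner_smul_right, hwv] at hz
  rcases mul_eq_zero.mp hz with h1 | h1
  · exact hnv.ne' (inv_eq_zero.mp h1)
  · exact hv0 (inner_self_eq_zero.mp h1)

open Filter Topology in
lemma ff_rigid {n : ℕ} (κ : ℝ) (hκ0 : 0 < κ) (hκ1 : κ < 1)
    (x p q : EuclideanSpace ℝ (Fin n)) (hx : ‖x‖ = 1) (hp : ‖p‖ = 1) (hq : ‖q‖ = 1)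
    (hxp : κ ≤ ⟪x, p⟫) (hxq : κ ≤ ⟪x, q⟫) (a b : ℝ) (ha : 0 < a) (hb : 0 < b)
    (heq : a / (1 - κ * ⟪p, x⟫) = b / (1 - κ * ⟪q, x⟫))
    (h : ∀ᶠ y in 𝓝[Metric.sphere 0 1] x,
      a / (1 - κ * ⟪p, y⟫) ≤ b / (1 - κ * ⟪q, y⟫)) : p = q := by
  have hpos : ∀ r y : EuclideanSpace ℝ (Fin n), ‖r‖ = 1 → ‖y‖ = 1 → 0 < 1 - κ * ⟪r, y⟫ := by
    intro r y hr hy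
    have := real_inner_le_norm r y
    rw [hr, hy] at this
    nlinarith
  have heq' : a * (1 - κ * ⟪q, x⟫) = b * (1 - κ * ⟪p, x⟫) :=
    (div_eq_div_iff (hpos p x hp hx).ne' (hpos q x hq hx).ne').mp heq
  have hc := ff_critical x (b • p - a • q) hx (by
    filter_upwards [h, self_mem_nhdsWithin] with y hy hys
    have hyn : ‖y‖ = 1 := mem_sphere_zero_iff_norm.mp hys
    have := (div_le_div_iff₀ (hpos p y hp hyn) (hpos q y hq hyn)).mp hy
    rw [inner_sub_left, inner_sub_left, real_inner_smul_left, real_inner_smul_left,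
      real_inner_smul_left, real_inner_smul_left]
    nlinarith)
  set l := ⟪b • p - a • q, x⟫ with hl
  have hl' : l = b * ⟪p, x⟫ - a * ⟪q, x⟫ := by
    simp [hl, inner_sub_left, inner_smul_left]
  have hab : a = b - κ * l := by rw [hl']; linarith
  have haq : a • q = b • p - l • x := by rw [← hc]; abel
  have hn : a ^ 2 = b ^ 2 - 2 * (b * l * ⟪p, x⟫) + l ^ 2 := by
    have h1 : ‖a • q‖ ^ 2 = ‖b • p - l • x‖ ^ 2 := by rw [haq]
    rw [norm_sub_sq_real, norm_smul, norm_smul, norm_smul, hp, hq, hx, inner_smul_left,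
      inner_smul_right] at h1
    simp only [Real.norm_eq_abs, mul_one, sq_abs, conj_trivial] at h1
    linarith
  rw [real_inner_comm] at hxp hxq
  have hl0 : l = 0 := by
    by_contra hne
    have h1 : l * (2 * b * (⟪p, x⟫ - κ) - l * (1 - κ ^ 2)) = 0 := by
      rw [hab] at hn; linarith
    have h2 : 2 * b * (⟪p, x⟫ - κ) = l * (1 - κ ^ 2) := by
      rcases mul_eq_zero.mp h1 with h | h
      · exact absurd h hne
      · linarith
    have h3 : κ * a ≤ a * ⟪q, x⟫ := by nlinarith
    have h4 : 0 ≤ b * (⟪p, x⟫ - κ) := mul_nonneg hb.le (by linarith)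
    have h5 : l * (1 - κ ^ 2) ≤ b * (⟪p, x⟫ - κ) := by
      have : a * ⟪q, x⟫ = b * ⟪p, x⟫ - l := by linarith
      rw [this, hab] at h3
      linarith
    have h6 : l * (1 - κ ^ 2) = 0 := by linarith
    rcases mul_eq_zero.mp h6 with h | h
    · exact hne h
    · nlinarith
  have hab' : a = b := by rw [hab, hl0]; ring
  rw [hl0, zero_smul, sub_zero, hab'] at haq
  exact (smul_right_injective _ hb.ne' haq).symm

lemma ff_slice_null {n : ℕ} (hn : 2 ≤ n) (w : EuclideanSpace ℝ (Fin n)) (hw : w ≠ 0) (d : ℝ) :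
    sphereMeasure n {x | ⟪w, x⟫ = d} = 0 := by
  have hcl : IsClosed {x : EuclideanSpace ℝ (Fin n) | ⟪w, x⟫ = d} :=
    isClosed_eq (by fun_prop) continuous_const
  rw [sphereMeasure, Measure.restrict_apply hcl.measurableSet]
  let H : Submodule ℝ (EuclideanSpace ℝ (Fin n)) := (ℝ ∙ w)ᗮ
  have hfr : Module.finrank ℝ H + 1 = n := by
    have h1 := Submodule.finrank_add_finrank_orthogonal (ℝ ∙ w)
    rw [finrank_span_singleton hw, finrank_euclideanSpace_fin] at h1
    change Module.finrank ℝ (ℝ ∙ w)ᗮ + 1 = n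
    omega
  have hfr' : ((Module.finrank ℝ H : ℕ) : ℝ) = (n : ℝ) - 1 := by
    have : ((Module.finrank ℝ H + 1 : ℕ) : ℝ) = n := by rw [hfr]
    push_cast at this
    linarith
  have hnt : Nontrivial H := Module.nontrivial_of_finrank_pos (R := ℝ) (by omega)
  set p : EuclideanSpace ℝ (Fin n) := (d / ‖w‖ ^ 2) • w with hp
  have hw2 : ‖w‖ ^ 2 ≠ 0 := pow_ne_zero _ (norm_ne_zero_iff.mpr hw)
  let φ : H → EuclideanSpace ℝ (Fin n) := fun v => (v : EuclideanSpace ℝ (Fin n)) + p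
  have hφ : Isometry φ := by
    apply Isometry.of_dist_eq
    intro u v
    simp only [φ, dist_add_right]
    rfl
  have hsub : {x : EuclideanSpace ℝ (Fin n) | ⟪w, x⟫ = d} ∩ Metric.sphere 0 1 ⊆
      φ '' (Metric.sphere 0 (Real.sqrt (1 - ‖p‖ ^ 2))) := by
    rintro x ⟨hx1, hx2⟩
    have hx1' : ⟪w, x⟫ = d := hx1
    have hxn : ‖x‖ = 1 := mem_sphere_zero_iff_norm.mp hx2
    have hperp : ⟪w, x - p⟫ = 0 := by
      rw [inner_sub_right, hx1', hp, inner_smul_right, real_inner_self_eq_norm_sq]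
      field_simp
      simp
    have hmem : x - p ∈ H := Submodule.mem_orthogonal_singleton_iff_inner_right.mpr hperp
    refine ⟨⟨x - p, hmem⟩, ?_, by simp [φ]⟩
    rw [mem_sphere_zero_iff_norm]
    have h1 : ‖x‖ ^ 2 = ‖x - p‖ ^ 2 + ‖p‖ ^ 2 := by
      have h2 : x = (x - p) + p := by abel
      conv_lhs => rw [h2]
      rw [norm_add_sq_real, hp, inner_smul_right, real_inner_comm, ← hp, hperp]
      ring
    have h3 : 1 - ‖p‖ ^ 2 = ‖x - p‖ ^ 2 := by rw [hxn] at h1; linarith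
    rw [h3, Real.sqrt_sq (norm_nonneg _)]
    rfl
  refine measure_mono_null hsub ?_
  rw [hφ.hausdorffMeasure_image (Or.inl (by
    have : (2 : ℝ) ≤ n := by exact_mod_cast hn
    linarith)), ← hfr']
  exact Measure.addHaar_sphere _ _ _

/-- Semi-discrete transport: existence of potentials with prescribed cell masses. -/
lemma ff_semidiscrete {α : Type*} [MeasurableSpace α] (ν : Measure α) [IsFiniteMeasure ν]
    {N : ℕ} [NeZero N] (c : Fin N → α → ℝ) (hc : ∀ i, Measurable (c i))
    (C : ℝ) (hC : ∀ i x, |c i x| ≤ C)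
    (htie : ∀ i j, i ≠ j → ∀ t : ℝ, ν {x | c i x - c j x = t} = 0)
    (g : Fin N → ℝ) (hg : ∀ i, 0 < g i) (hmass : ν Set.univ = ∑ i, ENNReal.ofReal (g i)) :
    ∃ β : Fin N → ℝ, ∀ i, ν {x | ∀ j, β i + c i x ≤ β j + c j x} = ENNReal.ofReal (g i) := by
  classical
  let M : (Fin N → ℝ) → α → ℝ := fun β x => ⨅ i, (β i + c i x)
  have Mle : ∀ β x i, M β x ≤ β i + c i x := fun β x i => ciInf_le (Set.finite_range _).bddBelow i
  have leM : ∀ β x a, (∀ i, a ≤ β i + c i x) → a ≤ M β x := fun β x a h => le_ciInf h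
  have Mex : ∀ β x, ∃ i, β i + c i x = M β x := fun β x => exists_eq_ciInf_of_finite
  have Mmeas : ∀ β, Measurable (M β) := fun β => Measurable.iInf (fun i => (hc i).const_add _)
  have Mlip : ∀ β β' x, M β x ≤ M β' x + dist β β' := by
    intro β β' x
    obtain ⟨i, hi⟩ := Mex β' x
    have h1 := Mle β x i
    have h2 := dist_le_pi_dist β β' i
    rw [Real.dist_eq] at h2
    have := le_abs_self (β i - β' i)
    linarith
  have C0 : 0 ≤ C := by
    by_cases hne : Nonempty α
    · obtain ⟨x⟩ := hne
      exact (abs_nonneg _).trans (hC 0 x)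
    · exfalso
      have : IsEmpty α := not_nonempty_iff.mp hne
      rw [Set.univ_eq_empty_iff.mpr this, measure_empty] at hmass
      have h0 := (Finset.sum_eq_zero_iff.mp hmass.symm) 0 (Finset.mem_univ _)
      exact absurd (ENNReal.ofReal_eq_zero.mp h0) (not_le.mpr (hg 0))
  have Mb0 : ∀ x, |M 0 x| ≤ C := by
    intro x
    rw [abs_le]
    refine ⟨leM _ _ _ fun i => ?_, (Mle 0 x 0).trans ?_⟩
    · simpa using (abs_le.mp (hC i x)).1
    · simpa using (abs_le.mp (hC 0 x)).2
  have Mint : ∀ β, Integrable (M β) ν := by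
    intro β
    refine Integrable.of_bound (Mmeas β).aestronglyMeasurable (C + dist β 0)
      (Filter.Eventually.of_forall fun x => ?_)
    rw [Real.norm_eq_abs, abs_le]
    have h1 := Mlip β 0 x
    have h2 := Mlip 0 β x
    rw [dist_comm] at h2
    have h3 := abs_le.mp (Mb0 x)
    constructor <;> linarith [h3.1, h3.2]
  set V : ℝ := ν.real Set.univ with hV
  have hVg : V = ∑ i, g i := by
    rw [hV, measureReal_def, hmass, ENNReal.toReal_sum (fun _ _ => ENNReal.ofReal_ne_top)]
    exact Finset.sum_congr rfl fun i _ => ENNReal.toReal_ofReal (hg i).le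
  have V0 : 0 ≤ V := measureReal_nonneg
  let Φ : (Fin N → ℝ) → ℝ := fun β => ∫ x, M β x ∂ν - ∑ i, g i * β i
  have Φcont : Continuous Φ := by
    refine Continuous.sub ?_ (by fun_prop)
    have hle : ∀ β β', (∫ x, M β x ∂ν) ≤ (∫ x, M β' x ∂ν) + V * dist β β' := by
      intro β β'
      have h1 : (∫ x, M β x ∂ν) ≤ ∫ x, (M β' x + dist β β') ∂ν :=
        integral_mono (Mint β) ((Mint β').add (integrable_const _)) (Mlip β β')
      rw [integral_add (Mint β') (integrable_const _), integral_const, smul_eq_mul] at h1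
      exact h1
    have : LipschitzWith V.toNNReal (fun β => ∫ x, M β x ∂ν) := by
      refine LipschitzWith.of_dist_le_mul fun β β' => ?_
      rw [Real.coe_toNNReal _ V0, Real.dist_eq, abs_le]
      have h1 := hle β β'
      have h2 := hle β' β
      rw [dist_comm] at h2
      constructor <;> linarith
    exact this.continuous
  have Φshift : ∀ β t, Φ (fun i => β i + t) = Φ β := by
    intro β t
    have h1 : ∀ x, M (fun i => β i + t) x = M β x + t := by
      intro x
      apply le_antisymm
      · obtain ⟨i, hi⟩ := Mex β x
        have := Mle (fun i => β i + t) x i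
        linarith
      · refine leM _ _ _ fun i => ?_
        have := Mle β x i
        linarith
    simp only [Φ]
    rw [integral_congr_ae (Filter.Eventually.of_forall h1), integral_add (Mint β) (integrable_const _),
      integral_const, smul_eq_mul]
    change _ + V * t - _ = _
    simp only [mul_add, Finset.sum_add_distrib]
    rw [← Finset.sum_mul, ← hVg]
    ring
  obtain ⟨k0, hk0⟩ := Finite.exists_min g
  set R : ℝ := (2 * C * V + 1) / g k0 with hR
  have hRnn : 0 ≤ R := by have := hg k0; positivity
  have hRg : ∀ k, 2 * C * V + 1 ≤ g k * R := by
    intro k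
    have h1 : g k0 * R = 2 * C * V + 1 := by rw [hR]; field_simp [(hg k0).ne']
    nlinarith [hk0 k]
  have hcomp : IsCompact (Set.Icc (0 : Fin N → ℝ) (fun _ => R)) := isCompact_Icc
  obtain ⟨β, hβK, hβmax⟩ := hcomp.exists_isMaxOn ⟨0, le_rfl, fun _ => hRnn⟩ Φcont.continuousOn
  have hΦ0 : -(C * V) ≤ Φ 0 := by
    have h1 : ∫ _ : α, (-C) ∂ν ≤ ∫ x, M 0 x ∂ν :=
      integral_mono (integrable_const _) (Mint 0) (fun x => (abs_le.mp (Mb0 x)).1)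
    rw [integral_const, smul_eq_mul] at h1
    change V * -C ≤ _ at h1
    simp only [Φ, Pi.zero_apply, mul_zero, Finset.sum_const_zero, sub_zero]
    linarith
  have hΦ0' : Φ 0 ≤ Φ β := hβmax (show (0 : Fin N → ℝ) ∈ Set.Icc (0 : Fin N → ℝ) (fun _ => R) from
    ⟨le_rfl, fun _ => hRnn⟩)
  have hglob0 : ∀ γ : Fin N → ℝ, (∀ i, 0 ≤ γ i) → (∃ i, γ i = 0) → Φ γ ≤ Φ β := by
    intro γ hγ ⟨i0, hi0⟩
    by_cases hbox : ∀ i, γ i ≤ R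
    · exact hβmax (show γ ∈ Set.Icc (0 : Fin N → ℝ) (fun _ => R) from ⟨hγ, hbox⟩)
    · push Not at hbox
      obtain ⟨k, hk⟩ := hbox
      have h1 : ∫ x, M γ x ∂ν ≤ ∫ _ : α, C ∂ν := by
        refine integral_mono (Mint γ) (integrable_const _) fun x => ?_
        have := Mle γ x i0
        have h2 := (abs_le.mp (hC i0 x)).2
        dsimp only
        linarith
      rw [integral_const, smul_eq_mul] at h1
      change _ ≤ V * C at h1
      have h2 : g k * γ k ≤ ∑ i, g i * γ i :=
        Finset.single_le_sum (f := fun i => g i * γ i)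
          (fun i _ => mul_nonneg (hg i).le (hγ i)) (Finset.mem_univ k)
      have h3 : g k * R ≤ g k * γ k := mul_le_mul_of_nonneg_left hk.le (hg k).le
      have h4 := hRg k
      have : Φ γ ≤ V * C - (2 * C * V + 1) := by
        simp only [Φ]; linarith
      linarith
  have hglob : ∀ γ, Φ γ ≤ Φ β := by
    intro γ
    obtain ⟨k, hk⟩ := Finite.exists_min γ
    rw [← Φshift γ (-γ k)]
    exact hglob0 _ (fun i => by have := hk i; linarith) ⟨k, by ring⟩
  let A : (Fin N → ℝ) → Fin N → Set α := fun β i => {x | ∀ j, β i + c i x ≤ β j + c j x}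
  have Ameas : ∀ β i, MeasurableSet (A β i) := by
    intro β i
    have : A β i = ⋂ j, {x | β i + c i x ≤ β j + c j x} := by ext x; simp [A]
    rw [this]
    exact MeasurableSet.iInter fun j => measurableSet_le ((hc i).const_add _) ((hc j).const_add _)
  have key : ∀ i, ∀ s : ℝ, 0 < s → g i ≤ ν.real (A (Function.update β i (β i - s)) i) := by
    intro i s hs
    set γ := Function.update β i (β i - s) with hγ
    have hγi : γ i = β i - s := by simp [hγ]
    have hγj : ∀ j, j ≠ i → γ j = β j := fun j hj => by simp [hγ, hj]
    have h1 := hglob γ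
    have h2 : ∑ j, g j * γ j = ∑ j, g j * β j - g i * s := by
      have : ∀ j, g j * γ j = g j * β j - (if j = i then g i * s else 0) := by
        intro j
        by_cases hj : j = i
        · subst hj; rw [hγi]; simp; ring
        · rw [hγj j hj]; simp [hj]
      rw [Finset.sum_congr rfl fun j _ => this j, Finset.sum_sub_distrib]
      simp
    have h3 : ∀ x, M β x ≤ M γ x + (A γ i).indicator (fun _ => s) x := by
      intro x
      by_cases hxA : x ∈ A γ i
      · rw [Set.indicator_of_mem hxA]
        have h4 : γ i + c i x ≤ M γ x := leM _ _ _ hxA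
        have := Mle β x i
        linarith
      · rw [Set.indicator_of_notMem hxA]
        obtain ⟨j, hj⟩ := Mex γ x
        have hji : j ≠ i := by
          rintro rfl
          exact hxA fun k => hj ▸ Mle γ x k
        have := Mle β x j
        rw [hγj j hji] at hj
        linarith
    have hint : Integrable ((A γ i).indicator (fun _ => s)) ν :=
      (integrable_const s).indicator (Ameas γ i)
    have h5 : ∫ x, M β x ∂ν ≤ ∫ x, (M γ x + (A γ i).indicator (fun _ => s) x) ∂ν :=
      integral_mono (Mint β) ((Mint γ).add hint) h3
    rw [integral_add (Mint γ) hint, integral_indicator_const _ (Ameas γ i), smul_eq_mul] at h5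
    simp only [Φ] at h1
    rw [h2] at h1
    have h6 : g i * s ≤ ν.real (A γ i) * s := by linarith
    exact le_of_mul_le_mul_right h6 hs
  have hge : ∀ i, ENNReal.ofReal (g i) ≤ ν (A β i) := by
    intro i
    let B : ℕ → Set α := fun k => A (Function.update β i (β i - 1 / ((k : ℝ) + 1))) i
    have hmemB : ∀ s x, x ∈ A (Function.update β i (β i - s)) i ↔
        ∀ j, j ≠ i → β i - s + c i x ≤ β j + c j x := by
      intro s x
      constructor
      · intro h j hj
        have := h j
        simpa [hj] using this
      · intro h j
        by_cases hj : j = i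
        · subst hj; exact le_rfl
        · simpa [hj] using h j hj
    have hanti : Antitone B := by
      intro k l hkl x hx
      have hd : 1 / ((l : ℝ) + 1) ≤ 1 / ((k : ℝ) + 1) := Nat.one_div_le_one_div hkl
      refine (hmemB _ _).mpr fun j hj => ?_
      have := (hmemB _ _).mp hx j hj
      linarith
    have hinter : ⋂ k, B k ⊆ A β i := by
      intro x hx j
      by_cases hj : j = i
      · subst hj; exact le_rfl
      · rw [Set.mem_iInter] at hx
        refine le_of_forall_pos_le_add fun ε hε => ?_
        obtain ⟨k, hk⟩ := exists_nat_one_div_lt hε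
        have := (hmemB _ _).mp (hx k) j hj
        linarith
    refine le_trans ?_ (measure_mono hinter)
    have htend := tendsto_measure_iInter_atTop (μ := ν) (s := B)
      (fun k => (Ameas _ i).nullMeasurableSet) hanti ⟨0, measure_ne_top _ _⟩
    refine ge_of_tendsto' htend fun k => ?_
    have hk := key i (1 / ((k : ℝ) + 1)) Nat.one_div_pos_of_nat
    rw [measureReal_def] at hk
    exact ENNReal.ofReal_le_of_le_toReal hk
  have hdisj : Pairwise (Function.onFun (AEDisjoint ν) (A β)) := by
    intro i j hij
    refine measure_mono_null ?_ (htie i j hij (β j - β i))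
    rintro x ⟨h1, h2⟩
    have h3 := h1 j
    have h4 := h2 i
    change c i x - c j x = β j - β i
    linarith
  have hsum : ∑ i, ν (A β i) ≤ ∑ i, ENNReal.ofReal (g i) := by
    rw [← hmass, ← tsum_fintype (L := .unconditional _) (fun i => ν (A β i)),
      ← measure_iUnion₀ hdisj (fun i => (Ameas β i).nullMeasurableSet)]
    exact measure_mono (Set.subset_univ _)
  refine ⟨β, fun i => le_antisymm ?_ (hge i)⟩
  by_contra hlt
  rw [not_le] at hlt
  have h1 : ∀ j, g j ≤ ν.real (A β j) := fun j =>
    (ENNReal.ofReal_le_iff_le_toReal (measure_ne_top _ _)).mp (hge j)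
  have h2 : g i < ν.real (A β i) :=
    (ENNReal.ofReal_lt_iff_lt_toReal (hg i).le (measure_ne_top _ _)).mp hlt
  have h3 : ∑ j, g j < ∑ j, ν.real (A β j) :=
    Finset.sum_lt_sum (fun j _ => h1 j) ⟨i, Finset.mem_univ _, h2⟩
  have h4 : ∑ j, ν.real (A β j) ≤ V := by
    rw [hV, measureReal_def, hmass]
    simp only [measureReal_def]
    rw [← ENNReal.toReal_sum (fun _ _ => measure_ne_top _ _)]
    refine ENNReal.toReal_mono ?_ hsum
    exact ENNReal.sum_ne_top.mpr fun _ _ => ENNReal.ofReal_ne_top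
  linarith

/-- Theorem 7.2: existence of a far field refractor (case `κ < 1`) refracting onto finitely
many directions `m₁,…,m_N` with prescribed energies `g₁,…,g_N`. -/
theorem stmt18 {n : ℕ} (hn : 2 ≤ n) (κ : ℝ) (hκ0 : 0 < κ) (hκ1 : κ < 1)
    (Ω Ωs : Set (EuclideanSpace ℝ (Fin n)))
    -- Ω and Ω* are domains in the unit sphere, Ω with boundary of measure zero
    (hΩsph : Ω ⊆ Metric.sphere 0 1) (hΩssph : Ωs ⊆ Metric.sphere 0 1)
    (hΩopen : ∃ U : Set (EuclideanSpace ℝ (Fin n)), IsOpen U ∧ Ω = U ∩ Metric.sphere 0 1)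
    (hbdry : sphereMeasure n (closure Ω \ Ω) = 0)
    -- the compatibility condition x·m ≥ κ
    (hΩΩs : ∀ x ∈ closure Ω, ∀ m ∈ closure Ωs, κ ≤ ⟪x, m⟫)
    -- the data: distinct directions mᵢ ∈ Ω̄* with x·mᵢ ≥ κ on Ω
    {N : ℕ} [NeZero N] (hN : 2 ≤ N)
    (m : Fin N → EuclideanSpace ℝ (Fin n)) (hmmem : ∀ i, m i ∈ closure Ωs)
    (hminj : Function.Injective m)
    (hxm : ∀ x ∈ Ω, ∀ i, κ ≤ ⟪x, m i⟫)
    (g : Fin N → ℝ) (hg : ∀ i, 0 < g i)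
    (f : EuclideanSpace ℝ (Fin n) → ℝ) (hfmeas : Measurable f)
    (hfnn : ∀ᵐ x ∂((sphereMeasure n).restrict Ω), 0 ≤ f x)
    (hmass : ∫⁻ x in Ω, ENNReal.ofReal (f x) ∂(sphereMeasure n) =
      ∑ i, ENNReal.ofReal (g i)) :
    ∃ b : Fin N → ℝ, (∀ i, 0 < b i) ∧
      IsFarFieldRefractor κ Ω Ωs (fun x => ⨅ i, b i / (1 - κ * ⟪m i, x⟫)) ∧
      ∀ F : Set (EuclideanSpace ℝ (Fin n)), MeasurableSet F → F ⊆ closure Ωs →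
        ∫⁻ x in ffPreimage κ Ω Ωs (fun x => ⨅ i, b i / (1 - κ * ⟪m i, x⟫)) F,
            ENNReal.ofReal (f x) ∂(sphereMeasure n) =
          ∑ i, F.indicator (fun _ => ENNReal.ofReal (g i)) (m i) := by
  classical
  obtain ⟨U, hU, hΩU⟩ := hΩopen
  have hΩmeas : MeasurableSet Ω := by
    rw [hΩU]; exact hU.measurableSet.inter Metric.isClosed_sphere.measurableSet
  have hclΩ : ∀ x ∈ closure Ω, ‖x‖ = 1 := fun x hx =>
    mem_sphere_zero_iff_norm.mp (closure_minimal hΩsph Metric.isClosed_sphere hx)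
  have hclΩs : ∀ x ∈ closure Ωs, ‖x‖ = 1 := fun x hx =>
    mem_sphere_zero_iff_norm.mp (closure_minimal hΩssph Metric.isClosed_sphere hx)
  have hlow : ∀ p ∈ closure Ωs, ∀ x ∈ closure Ω, 1 - κ ≤ 1 - κ * ⟪p, x⟫ := by
    intro p hp x hx
    have := real_inner_le_norm p x
    rw [hclΩ x hx, hclΩs p hp] at this
    nlinarith
  have hup : ∀ p ∈ closure Ωs, ∀ x ∈ closure Ω, 1 - κ * ⟪p, x⟫ ≤ 1 := by
    intro p hp x hx
    have := hΩΩs x hx p hp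
    rw [real_inner_comm] at this
    nlinarith
  have hposm : ∀ i, ∀ x ∈ closure Ω, 0 < 1 - κ * ⟪m i, x⟫ := fun i x hx =>
    lt_of_lt_of_le (by linarith) (hlow (m i) (hmmem i) x hx)
  -- the costs
  let c : Fin N → EuclideanSpace ℝ (Fin n) → ℝ := fun i =>
    Ω.indicator (fun x => - Real.log (1 - κ * ⟪m i, x⟫))
  have hcΩ : ∀ i, ∀ x ∈ Ω, c i x = - Real.log (1 - κ * ⟪m i, x⟫) := fun i x hx =>
    Set.indicator_of_mem hx _
  have hcmeas : ∀ i, Measurable (c i) := by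
    intro i
    refine Measurable.indicator ?_ hΩmeas
    have h1 : Continuous fun x : EuclideanSpace ℝ (Fin n) => 1 - κ * ⟪m i, x⟫ := by fun_prop
    exact (Real.measurable_log.comp h1.measurable).neg
  have hcb : ∀ i x, |c i x| ≤ - Real.log (1 - κ) := by
    intro i x
    have hlog : Real.log (1 - κ) ≤ 0 := Real.log_nonpos (by linarith) (by linarith)
    by_cases hx : x ∈ Ω
    · rw [hcΩ i x hx, abs_neg, abs_le]
      have hx' := subset_closure hx
      have h1 := Real.log_le_log (by linarith) (hlow (m i) (hmmem i) x hx')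
      have h2 := Real.log_nonpos (hposm i x hx').le (hup (m i) (hmmem i) x hx')
      constructor <;> linarith
    · simp only [c, Set.indicator_of_notMem hx, abs_zero]
      linarith
  have htieσ : ∀ i j, i ≠ j → ∀ t : ℝ,
      sphereMeasure n ({x | c i x - c j x = t} ∩ Ω) = 0 := by
    intro i j hij t
    have hw : κ • (Real.exp t • m i - m j) ≠ 0 := by
      intro h0
      have h1 : Real.exp t • m i = m j :=
        sub_eq_zero.mp ((smul_eq_zero.mp h0).resolve_left hκ0.ne')
      have h2 : ‖Real.exp t • m i‖ = ‖m j‖ := by rw [h1]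
      rw [norm_smul, hclΩs _ (hmmem i), hclΩs _ (hmmem j), mul_one, Real.norm_eq_abs,
        abs_of_pos (Real.exp_pos t)] at h2
      rw [h2, one_smul] at h1
      exact hij (hminj h1)
    refine measure_mono_null ?_ (ff_slice_null hn _ hw (Real.exp t - 1))
    rintro x ⟨hx, hxΩ⟩
    have hx' := subset_closure hxΩ
    have h1 : c i x - c j x = t := hx
    rw [hcΩ i x hxΩ, hcΩ j x hxΩ] at h1
    have h2 : Real.log (1 - κ * ⟪m j, x⟫) = t + Real.log (1 - κ * ⟪m i, x⟫) := by linarith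
    have h3 : 1 - κ * ⟪m j, x⟫ = Real.exp t * (1 - κ * ⟪m i, x⟫) := by
      rw [← Real.exp_log (hposm j x hx'), h2, Real.exp_add, Real.exp_log (hposm i x hx')]
    change ⟪κ • (Real.exp t • m i - m j), x⟫ = Real.exp t - 1
    rw [real_inner_smul_left, inner_sub_left, real_inner_smul_left]
    linarith
  set F0 : EuclideanSpace ℝ (Fin n) → ENNReal := fun x => ENNReal.ofReal (f x) with hF0
  let ν : Measure (EuclideanSpace ℝ (Fin n)) := ((sphereMeasure n).restrict Ω).withDensity F0
  have hνuniv : ν Set.univ = ∑ i, ENNReal.ofReal (g i) := by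
    rw [← hmass, withDensity_apply _ MeasurableSet.univ, Measure.restrict_univ]
  have hνfin : IsFiniteMeasure ν := ⟨by
    rw [hνuniv]
    exact ENNReal.sum_lt_top.mpr fun _ _ => ENNReal.ofReal_lt_top⟩
  have hνtie : ∀ i j, i ≠ j → ∀ t : ℝ, ν {x | c i x - c j x = t} = 0 := by
    intro i j hij t
    refine withDensity_absolutelyContinuous _ _ ?_
    rw [Measure.restrict_apply' hΩmeas]
    exact htieσ i j hij t
  obtain ⟨β, hβ⟩ := ff_semidiscrete ν c hcmeas _ hcb hνtie g hg hνuniv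
  let A : Fin N → Set (EuclideanSpace ℝ (Fin n)) := fun i => {x | ∀ j, β i + c i x ≤ β j + c j x}
  have hAmeas : ∀ i, MeasurableSet (A i) := by
    intro i
    have : A i = ⋂ j, {x | β i + c i x ≤ β j + c j x} := by ext x; simp [A]
    rw [this]
    exact MeasurableSet.iInter fun j =>
      measurableSet_le ((hcmeas i).const_add _) ((hcmeas j).const_add _)
  let b : Fin N → ℝ := fun i => Real.exp (β i)
  have hb : ∀ i, 0 < b i := fun i => Real.exp_pos _
  set ρ : EuclideanSpace ℝ (Fin n) → ℝ := fun x => ⨅ i, b i / (1 - κ * ⟪m i, x⟫) with hρ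
  have ρle : ∀ x i, ρ x ≤ b i / (1 - κ * ⟪m i, x⟫) := fun x i =>
    ciInf_le (Set.finite_range _).bddBelow i
  have ρex : ∀ x, ∃ i, b i / (1 - κ * ⟪m i, x⟫) = ρ x := fun x => exists_eq_ciInf_of_finite
  have hexp : ∀ i, ∀ x ∈ Ω, b i / (1 - κ * ⟪m i, x⟫) = Real.exp (β i + c i x) := by
    intro i x hx
    rw [hcΩ i x hx, Real.exp_add, Real.exp_neg, Real.exp_log (hposm i x (subset_closure hx))]
    rfl
  have hcont : ∀ i, ContinuousOn (fun x => b i / (1 - κ * ⟪m i, x⟫)) (closure Ω) := by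
    intro i
    refine ContinuousOn.div continuousOn_const (by fun_prop) fun x hx => (hposm i x hx).ne'
  have hsupp : ∀ x i, b i / (1 - κ * ⟪m i, x⟫) = ρ x → FFSupportsAt κ Ω Ωs ρ (m i) (b i) x :=
    fun x i h => ⟨hmmem i, hb i, fun y _ => ρle y i, h.symm⟩
  refine ⟨b, hb, ⟨?_, ?_, ?_⟩, ?_⟩
  · have h1 : ρ = fun x => Finset.univ.inf' Finset.univ_nonempty
        (fun i => b i / (1 - κ * ⟪m i, x⟫)) := by
      ext x; rw [Finset.inf'_univ_eq_ciInf]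
    change ContinuousOn ρ _
    rw [h1]
    exact ContinuousOn.finset_inf'_apply _ fun i _ => hcont i
  · intro x hx
    obtain ⟨i, hi⟩ := ρex x
    change 0 < ρ x
    rw [← hi]
    exact div_pos (hb i) (hposm i x hx)
  · intro x hx
    obtain ⟨i, hi⟩ := ρex x
    exact ⟨m i, b i, hsupp x i hi⟩
  intro F hF hFs
  change ∫⁻ x in ffPreimage κ Ω Ωs ρ F, F0 x ∂(sphereMeasure n) = _
  let T : Set (EuclideanSpace ℝ (Fin n)) :=
    ⋃ i, ⋃ j, ⋃ (_ : i ≠ j), ({x | c i x - c j x = β j - β i} ∩ Ω)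
  have hT : sphereMeasure n T = 0 :=
    measure_iUnion_null fun i => measure_iUnion_null fun j => measure_iUnion_null fun hij =>
      htieσ i j hij _
  let I : Finset (Fin N) := Finset.univ.filter fun i => m i ∈ F
  have hae : ffPreimage κ Ω Ωs ρ F =ᵐ[sphereMeasure n] ⋃ i ∈ I, (A i ∩ Ω) := by
    have hnull : sphereMeasure n ((closure Ω \ Ω) ∪ T) = 0 := measure_union_null hbdry hT
    rw [Filter.eventuallyEq_set]
    filter_upwards [measure_eq_zero_iff_ae_notMem.mp hnull] with x hx
    have hx1 : x ∉ closure Ω \ Ω := fun h => hx (Or.inl h)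
    have hx2 : x ∉ T := fun h => hx (Or.inr h)
    simp only [Set.mem_iUnion, I, Finset.mem_filter, Finset.mem_univ, true_and, exists_prop]
    constructor
    · rintro ⟨hxc, q, ⟨b', hq, hb', hle, heq⟩, hqF⟩
      have hxΩ : x ∈ Ω := by by_contra h; exact hx1 ⟨hxc, h⟩
      obtain ⟨i, hi⟩ := ρex x
      have hxA : x ∈ A i := by
        intro j
        have := ρle x j
        rw [← hi, hexp i x hxΩ, hexp j x hxΩ] at this
        exact Real.exp_le_exp.mp this
      have hstrict : ∀ j, j ≠ i → b i / (1 - κ * ⟪m i, x⟫) < b j / (1 - κ * ⟪m j, x⟫) := by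
        intro j hj
        rw [hexp i x hxΩ, hexp j x hxΩ, Real.exp_lt_exp]
        refine lt_of_le_of_ne (hxA j) fun he => hx2 ?_
        simp only [T, Set.mem_iUnion]
        refine ⟨i, j, hj.symm, ?_, hxΩ⟩
        change c i x - c j x = β j - β i
        linarith
      have hnhds : Ω ∈ nhdsWithin x (Metric.sphere 0 1) := by
        rw [hΩU, Set.inter_comm]
        refine inter_mem_nhdsWithin _ (hU.mem_nhds ?_)
        rw [hΩU] at hxΩ
        exact hxΩ.1
      have hclnhds : closure Ω ∈ nhdsWithin x (Metric.sphere 0 1) :=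
        Filter.mem_of_superset hnhds subset_closure
      have hle' : nhdsWithin x (Metric.sphere 0 1) ≤ nhdsWithin x (closure Ω) :=
        nhdsWithin_le_of_mem hclnhds
      have hev : ∀ᶠ y in nhdsWithin x (Metric.sphere 0 1), ∀ j,
          b i / (1 - κ * ⟪m i, y⟫) ≤ b j / (1 - κ * ⟪m j, y⟫) := by
        rw [Filter.eventually_all]
        intro j
        by_cases hj : j = i
        · subst hj; exact Filter.Eventually.of_forall fun _ => le_rfl
        · have h1 := ((hcont i) x hxc).mono_left hle'
          have h2 := ((hcont j) x hxc).mono_left hle'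
          filter_upwards [h1.eventually_lt h2 (hstrict j hj)] with y hy using hy.le
      have hmq : m i = q := by
        refine ff_rigid κ hκ0 hκ1 x (m i) q (hclΩ x hxc) (hclΩs _ (hmmem i)) (hclΩs _ hq)
          (hΩΩs x hxc _ (hmmem i)) (hΩΩs x hxc _ hq) (b i) b' (hb i) hb' (hi.trans heq) ?_
        filter_upwards [hev, hclnhds] with y hy hyc
        exact (le_ciInf hy).trans (hle y hyc)
      exact ⟨i, hmq ▸ hqF, hxA, hxΩ⟩
    · rintro ⟨i, hiF, hxA, hxΩ⟩
      refine ⟨subset_closure hxΩ, m i, ⟨b i, hsupp x i (le_antisymm (le_ciInf fun j => ?_)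
        (ρle x i))⟩, hiF⟩
      rw [hexp i x hxΩ, hexp j x hxΩ]
      exact Real.exp_le_exp.mpr (hxA j)
  rw [setLIntegral_congr hae, lintegral_biUnion_finset₀]
  · rw [Finset.sum_filter]
    refine Finset.sum_congr rfl fun i _ => ?_
    by_cases hi : m i ∈ F
    · rw [if_pos hi, Set.indicator_of_mem hi, ← hβ i, withDensity_apply _ (hAmeas i),
        Measure.restrict_restrict (hAmeas i)]
    · rw [if_neg hi, Set.indicator_of_notMem hi]
  · intro i _ j _ hij
    refine measure_mono_null ?_ hT
    rintro x ⟨⟨h1, hxΩ⟩, ⟨h2, _⟩⟩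
    simp only [T, Set.mem_iUnion]
    refine ⟨i, j, hij, ?_, hxΩ⟩
    have h3 := h1 j
    have h4 := h2 i
    change c i x - c j x = β j - β i
    linarith
  · exact fun i _ => ((hAmeas i).inter hΩmeas).nullMeasurableSet
end
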